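/- Let 1<p<∞, 1<q≤∞, and 0<β<1. Assume X is a complete geodesic metric space and μ satisfies the quantitative reverse doubling condition for some exponent σ>βp. Then for every closed set E⊂X the following conditions are equivalent: (i) E satisfies the Hajłasz–Triebel–Lizorkin (β,p,q)-capacity density condition with some constants Λ≥41 and c₁≤1/80; (ii) E satisfies the Riesz (β,p)-capacity density condition; (iii) E satisfies the Hausdorff content density condition of some codimension d with 0<d<βp; (iv) E satisfies the Hajłasz–Triebel–Lizorkin (β,p,q)-capacity density condition for all constants Λ≥41 and c₁≤1/80. -/

import Mathlib

open MeasureTheory Metric Set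
open scoped ENNReal NNReal

noncomputable section

namespace TLCap

variable {X : Type*} [MetricSpace X] [MeasurableSpace X] [BorelSpace X]

/-- `validIdx X n` means `n ≥ n₀`, i.e. `2^{-n} ≤ 2 diam X`;
all `n : ℤ` are valid when `X` is unbounded. -/
def validIdx (X : Type*) [PseudoMetricSpace X] (n : ℤ) : Prop :=
  ENNReal.ofReal ((2 : ℝ) ^ (-n)) ≤ 2 * EMetric.diam (Set.univ : Set X)

/-- The doubling condition for `μ`, with doubling constant `c`. -/
def IsDoubling (μ : Measure X) (c : ℝ≥0∞) : Prop :=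
  ∀ (x : X) (r : ℝ), 0 < r → μ (ball x (2 * r)) ≤ c * μ (ball x r)

/-- The reverse doubling condition with constant `c`. -/
def IsReverseDoubling (μ : Measure X) (c : ℝ≥0∞) : Prop :=
  ∀ (x : X) (r : ℝ), 0 < r → 2 * ENNReal.ofReal r < EMetric.diam (Set.univ : Set X) →
    μ (ball x (r / 2)) ≤ c * μ (ball x r)

/-- The quantitative reverse doubling condition with exponent `σ` and constant `c`. -/
def IsQRD (μ : Measure X) (σ : ℝ) (c : ℝ≥0∞) : Prop :=
  ∀ (x : X) (r R : ℝ), 0 < r → r < R →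
    ENNReal.ofReal R ≤ 2 * EMetric.diam (Set.univ : Set X) →
    μ (ball x r) ≤ c * ENNReal.ofReal ((r / R) ^ σ) * μ (ball x R)

open Classical in
/-- The `l^q` norm of a sequence of extended nonnegative reals (`q = ∞` allowed). -/
def lqNorm (q : ℝ≥0∞) (a : ℤ → ℝ≥0∞) : ℝ≥0∞ :=
  if q = ∞ then ⨆ k, a k else (∑' k, a k ^ q.toReal) ^ (1 / q.toReal)

/-- The mixed norm `‖g‖_{L^p(Ω; l^q)}`. -/
def mixedNorm (μ : Measure X) (Ω : Set X) (p : ℝ) (q : ℝ≥0∞) (g : ℤ → X → ℝ≥0∞) : ℝ≥0∞ :=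
  (∫⁻ x in Ω, lqNorm q (fun k => g k x) ^ p ∂μ) ^ (1 / p)

/-- `g = (g_k)_{k ∈ ℤ}` is a fractional `β`-Hajłasz gradient of `u` on `Ω`. -/
def IsFracGrad (μ : Measure X) (β : ℝ) (Ω : Set X) (u : X → ℝ) (g : ℤ → X → ℝ≥0∞) : Prop :=
  (∀ k, Measurable (g k)) ∧
  ∃ N : Set X, N ⊆ Ω ∧ μ N = 0 ∧
    ∀ (k : ℤ), ∀ x ∈ Ω \ N, ∀ y ∈ Ω \ N,
      (2 : ℝ) ^ (-k - 1) ≤ dist x y → dist x y < (2 : ℝ) ^ (-k) →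
      ENNReal.ofReal |u x - u y| ≤ ENNReal.ofReal (dist x y ^ β) * (g k x + g k y)

/-- The homogeneous Hajłasz–Triebel–Lizorkin seminorm `|u|_{Ṁ^β_{p,q}(Ω)}`. -/
def htlSeminorm (μ : Measure X) (β p : ℝ) (q : ℝ≥0∞) (Ω : Set X) (u : X → ℝ) : ℝ≥0∞ :=
  ⨅ g : {g : ℤ → X → ℝ≥0∞ // IsFracGrad μ β Ω u g}, mixedNorm μ Ω p q g.1

/-- The relative Hajłasz–Triebel–Lizorkin capacity `cap^β_{p,q}(E, 2B, ΛB)`,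
where `B = B(x₀, r)`. -/
def relCap (μ : Measure X) (β p : ℝ) (q : ℝ≥0∞) (E : Set X) (x₀ : X) (r Λ : ℝ) : ℝ≥0∞ :=
  ⨅ φ : {φ : X → ℝ // Continuous φ ∧ (∀ x ∈ E, 1 ≤ φ x) ∧ ∀ x ∉ ball x₀ (2 * r), φ x = 0},
    htlSeminorm μ β p q (ball x₀ (Λ * r)) φ.1 ^ p

open Classical in
/-- The potential `H_β f`. -/
def Hpot (μ : Measure X) (β : ℝ) (f : ℤ → X → ℝ≥0∞) (x : X) : ℝ≥0∞ :=
  ∑' n : ℤ, if validIdx X n then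
    (2 : ℝ≥0∞) ^ (-β * (n : ℝ)) *
      ∫⁻ y, (ball y ((2 : ℝ) ^ (-n))).indicator (fun _ => (1 : ℝ≥0∞)) x * f n y /
        μ (ball y ((2 : ℝ) ^ (-n))) ∂μ
  else 0

/-- A sequence `(f_n)_{n ≥ n₀}` of nonnegative Borel functions, realized as a sequence
indexed by `ℤ` vanishing at invalid indices. -/
def IsAdmissibleSeq (f : ℤ → X → ℝ≥0∞) : Prop :=
  (∀ n, Measurable (f n)) ∧ ∀ n, ¬ validIdx X n → f n = 0

/-- The Triebel–Lizorkin `(β,p,q)`-capacity `Cp^β_{p,q}(E)`. -/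
def CpCap (μ : Measure X) (β p : ℝ) (q : ℝ≥0∞) (E : Set X) : ℝ≥0∞ :=
  ⨅ f : {f : ℤ → X → ℝ≥0∞ // IsAdmissibleSeq f ∧ ∀ x ∈ E, 1 ≤ Hpot μ β f x},
    mixedNorm μ Set.univ p q f.1 ^ p

open Classical in
/-- The sequence `Ȟ_β ν`. -/
def Hcheck (μ ν : Measure X) (β : ℝ) : ℤ → X → ℝ≥0∞ := fun n x =>
  if validIdx X n then
    (2 : ℝ≥0∞) ^ (-β * (n : ℝ)) * ν (ball x ((2 : ℝ) ^ (-n))) / μ (ball x ((2 : ℝ) ^ (-n)))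
  else 0

/-- `ν` is a nonnegative Radon measure on the (compact) set `E`. -/
def IsRadonOn (ν : Measure X) (E : Set X) : Prop :=
  ν Eᶜ = 0 ∧ ν E ≠ ∞ ∧
  (∀ F : Set X, MeasurableSet F → F ⊆ E →
    ν F = ⨅ (U : Set X) (_ : IsOpen U) (_ : F ⊆ U ∩ E), ν (U ∩ E)) ∧
  (∀ F : Set X, MeasurableSet F → F ⊆ E →
    ν F = ⨆ (K : Set X) (_ : IsCompact K) (_ : K ⊆ F), ν K)

open Classical in
/-- The conjugate exponent, with `1' = ∞` and `∞' = 1`. -/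
def conjExp (q : ℝ≥0∞) : ℝ≥0∞ :=
  if q = 1 then ∞ else if q = ∞ then 1 else ENNReal.ofReal (q.toReal / (q.toReal - 1))

/-- `2^{-n₀}` (equal to `∞` when `X` is unbounded). -/
def radMax (X : Type*) [PseudoMetricSpace X] : ℝ≥0∞ :=
  ⨆ (n : ℤ) (_ : validIdx X n), ENNReal.ofReal ((2 : ℝ) ^ (-n))

/-- The fractional maximal function `M_β ν`. -/
def fracMax (μ ν : Measure X) (β : ℝ) (x : X) : ℝ≥0∞ :=
  ⨆ (r : ℝ) (_ : 0 < r) (_ : ENNReal.ofReal r ≤ radMax X),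
    ENNReal.ofReal (r ^ β) * ν (ball x r) / μ (ball x r)

/-- The Riesz potential `I_β ν` of a nonnegative Borel measure. -/
def rieszPot (μ ν : Measure X) (β : ℝ) (x : X) : ℝ≥0∞ :=
  ∫⁻ y in {x}ᶜ, ENNReal.ofReal (dist x y ^ β) / μ (ball x (dist x y)) ∂ν

/-- The Riesz `(β,p)`-capacity `R_{β,p}(E)`. -/
def rieszCap (μ : Measure X) (β p : ℝ) (E : Set X) : ℝ≥0∞ :=
  ⨅ f : {f : X → ℝ≥0∞ // Measurable f ∧ ∀ x ∈ E, 1 ≤ rieszPot μ (μ.withDensity f) β x},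
    ∫⁻ x, f.1 x ^ p ∂μ

/-- The `ρ`-restricted Hausdorff content of codimension `d`. -/
def hContent (μ : Measure X) (d : ℝ) (ρ : ℝ≥0∞) (F : Set X) : ℝ≥0∞ :=
  ⨅ c : {c : ℕ → X × ℝ //
      (∀ k, 0 < (c k).2 ∧ ENNReal.ofReal (c k).2 ≤ ρ) ∧ F ⊆ ⋃ k, ball (c k).1 (c k).2},
    ∑' k, μ (ball (c.1 k).1 (c.1 k).2) * ENNReal.ofReal ((c.1 k).2 ^ (-d))

/-- Partition of unity data at every valid scale: the balls `B(x_{n,i}, 2^{-n-1})` are pairwise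
disjoint, the balls `B(x_{n,i}, 2^{-n})` cover `X`, and `ψ_{n,i}` is the associated
partition of unity with constants `κ` and `L`. -/
def IsPartition {ι : ℤ → Type*} (pt : ∀ n, ι n → X)
    (ψ : ∀ n, ι n → X → ℝ) (κ L : ℝ) : Prop :=
  ∀ n : ℤ, validIdx X n →
    (∀ i j : ι n, i ≠ j →
        Disjoint (ball (pt n i) ((2:ℝ) ^ (-n - 1))) (ball (pt n j) ((2:ℝ) ^ (-n - 1)))) ∧
    (∀ x : X, ∃ i : ι n, x ∈ ball (pt n i) ((2:ℝ) ^ (-n))) ∧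
    (∀ (i : ι n) (x : X), 0 ≤ ψ n i x ∧ ψ n i x ≤ 1) ∧
    (∀ (i : ι n), ∀ x ∉ ball (pt n i) (6 * (2:ℝ) ^ (-n)), ψ n i x = 0) ∧
    (∀ (i : ι n), ∀ x ∈ ball (pt n i) (3 * (2:ℝ) ^ (-n)), κ ≤ ψ n i x) ∧
    (∀ i : ι n, LipschitzWith (Real.toNNReal ((2:ℝ) ^ n * L)) (ψ n i)) ∧
    (∀ x : X, HasSum (fun i : ι n => ψ n i x) 1)

open Classical in
/-- The discrete potential `L_β f`. -/
def discPot {ι : ℤ → Type*} (μ : Measure X) (β : ℝ) (pt : ∀ n, ι n → X)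
    (ψ : ∀ n, ι n → X → ℝ) (f : ℤ → X → ℝ≥0∞) (x : X) : ℝ≥0∞ :=
  ∑' n : ℤ, if validIdx X n then
    (2 : ℝ≥0∞) ^ (-β * (n : ℝ)) *
      ∑' i : ι n, ENNReal.ofReal (ψ n i x) *
        ((∫⁻ y in ball (pt n i) (3 * (2:ℝ) ^ (-n)), f n y ∂μ) /
          μ (ball (pt n i) (3 * (2:ℝ) ^ (-n))))
  else 0

/-- A geodesic metric space: any two points are joined by an isometric image of an interval. -/
def IsGeodesicSpace (X : Type*) [MetricSpace X] : Prop :=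
  ∀ x y : X, ∃ γ : ℝ → X, γ 0 = x ∧ γ (dist x y) = y ∧
    ∀ s ∈ Set.Icc (0:ℝ) (dist x y), ∀ t ∈ Set.Icc (0:ℝ) (dist x y),
      dist (γ s) (γ t) = |s - t|

/-- The Hajłasz–Triebel–Lizorkin `(β,p,q)`-capacity density condition with
constants `c₀, c₁, Λ`. -/
def HTLDensity (μ : Measure X) (β p : ℝ) (q : ℝ≥0∞) (E : Set X) (c₀ c₁ Λ : ℝ) : Prop :=
  ∀ x ∈ E, ∀ r : ℝ, 0 < r → ENNReal.ofReal r < ENNReal.ofReal c₁ * EMetric.diam E →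
    ENNReal.ofReal c₀ * relCap μ β p q (closure (ball x r)) x r Λ ≤
      relCap μ β p q (E ∩ closure (ball x r)) x r Λ

/-- The Riesz `(β,p)`-capacity density condition with constant `c₀`. -/
def RieszDensity (μ : Measure X) (β p : ℝ) (E : Set X) (c₀ : ℝ) : Prop :=
  ∀ x ∈ E, ∀ r : ℝ, 0 < r → ENNReal.ofReal (8 * r) < EMetric.diam E →
    ENNReal.ofReal c₀ * rieszCap μ β p (closure (ball x r)) ≤
      rieszCap μ β p (E ∩ closure (ball x r))

/-- The Hausdorff content density condition of codimension `d` with constant `c₀`. -/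
def HausdorffDensity (μ : Measure X) (d : ℝ) (E : Set X) (c₀ : ℝ) : Prop :=
  ∀ x ∈ E, ∀ r : ℝ, 0 < r → ENNReal.ofReal r < EMetric.diam E →
    ENNReal.ofReal c₀ * hContent μ d (ENNReal.ofReal r) (closure (ball x r)) ≤
      hContent μ d (ENNReal.ofReal r) (E ∩ closure (ball x r))

/-- The standing assumptions on a doubling measure. -/
structure IsDoublingMeasure (μ : Measure X) (c : ℝ≥0∞) : Prop where
  one_le : 1 ≤ c
  ne_top : c ≠ ∞
  doubling : IsDoubling μ c
  ball_pos : ∀ (x : X) (r : ℝ), 0 < r → 0 < μ (ball x r)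
  ball_ne_top : ∀ (x : X) (r : ℝ), μ (ball x r) ≠ ∞

namespace IsDoublingMeasure

variable {μ : Measure X} {c : ℝ≥0∞}

lemma ball_two_pow_le (h : IsDoublingMeasure μ c) (n : ℕ) (x : X) {t : ℝ} (ht : 0 < t) :
    μ (ball x (2 ^ n * t)) ≤ c ^ n * μ (ball x t) := by
  induction n with
  | zero => simp
  | succ n ih =>
    calc μ (ball x (2 ^ (n + 1) * t)) = μ (ball x (2 * (2 ^ n * t))) := by
          congr 2; ring
      _ ≤ c * μ (ball x (2 ^ n * t)) := h.doubling x _ (by positivity)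
      _ ≤ c * (c ^ n * μ (ball x t)) := by gcongr
      _ = c ^ (n + 1) * μ (ball x t) := by ring

lemma ball_le (h : IsDoublingMeasure μ c) (n : ℕ) {x y : X} {s t : ℝ} (ht : 0 < t)
    (hst : dist y x + s ≤ 2 ^ n * t) : μ (ball y s) ≤ c ^ n * μ (ball x t) :=
  (measure_mono (ball_subset_ball' (by linarith))).trans (h.ball_two_pow_le n x ht)

/-- A Vitali type covering lemma for a bounded set of centers. -/
lemma exists_covering (h : IsDoublingMeasure μ c) {F : Set X} {ρ : X → ℝ} {x₀ : X} {R : ℝ}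
    (hF : F ⊆ closedBall x₀ R) (hρ : ∀ y ∈ F, 0 < ρ y ∧ ρ y ≤ R) :
    ∃ S ⊆ F, S.Countable ∧ S.PairwiseDisjoint (fun y => ball y (ρ y)) ∧
      ∀ y ∈ F, ∃ z ∈ S, dist y z ≤ 5 * ρ z := by
  obtain ⟨S, hSF, hdisj, hcov⟩ := Vitali.exists_disjoint_subfamily_covering_enlargement_closedBall
    F id ρ R (fun a ha => (hρ a ha).2) 5 (by norm_num)
  have hdisj' : S.PairwiseDisjoint (fun y => ball y (ρ y)) :=
    fun a ha b hb hab => (hdisj ha hb hab).mono ball_subset_closedBall ball_subset_closedBall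
  refine ⟨S, hSF, ?_, hdisj', fun y hy => ?_⟩
  · set ν := μ.restrict (ball x₀ (3 * R)) with hν
    have : IsFiniteMeasure ν := ⟨by
      rw [hν, Measure.restrict_apply_univ]; exact (h.ball_ne_top _ _).lt_top⟩
    have hc := Measure.countable_meas_pos_of_disjoint_iUnion (μ := ν)
      (As := fun y : S => ball (y : X) (ρ y)) (fun _ => measurableSet_ball)
      (fun a b hab => hdisj' a.2 b.2 (fun hh => hab (Subtype.ext hh)))
    have hall : {i : S | 0 < ν (ball (i : X) (ρ i))} = Set.univ := by
      refine Set.eq_univ_of_forall fun i => ?_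
      have hi := hρ i (hSF i.2)
      have hsub : ball (i : X) (ρ i) ⊆ ball x₀ (3 * R) := by
        refine ball_subset_ball' ?_
        have := mem_closedBall.1 (hF (hSF i.2))
        linarith
      simp only [Set.mem_ofPred_eq, hν, Measure.restrict_apply measurableSet_ball,
        Set.inter_eq_left.2 hsub]
      exact h.ball_pos _ _ hi.1
    rw [hall] at hc
    exact Set.countable_coe_iff.1 (Set.countable_univ_iff.1 hc)
  · obtain ⟨z, hz, hyz⟩ := hcov y hy
    exact ⟨z, hz, hyz (mem_closedBall_self (hρ y hy).1.le)⟩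

lemma tsum_ball_le {S T : Set X} {ρ : X → ℝ} (hS : S.Countable)
    (hd : S.PairwiseDisjoint (fun y => ball y (ρ y))) (hT : ∀ y ∈ S, ball y (ρ y) ⊆ T)
    (ν : Measure X) : ∑' y : S, ν (ball (y : X) (ρ y)) ≤ ν T := by
  rw [← measure_biUnion hS hd (fun _ _ => measurableSet_ball)]
  exact measure_mono (Set.iUnion₂_subset hT)

lemma isCompact_closedBall [CompleteSpace X] (h : IsDoublingMeasure μ c) (x : X) (r : ℝ) :
    IsCompact (closedBall x r) := by
  refine isCompact_iff_totallyBounded_isComplete.2 ⟨?_, isClosed_closedBall.isComplete⟩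
  rw [Metric.totallyBounded_iff]
  intro ε hε
  set R := max r ε with hR
  have hRε : ε ≤ R := le_max_right _ _
  obtain ⟨S, hSF, hSc, hd, hcov⟩ := h.exists_covering (F := closedBall x r) (ρ := fun _ => ε / 6)
    (x₀ := x) (R := R) (closedBall_subset_closedBall (le_max_left _ _))
    (fun y _ => ⟨by positivity, by linarith⟩)
  refine ⟨S, ?_, fun y hy => ?_⟩
  · obtain ⟨n, hn⟩ : ∃ n : ℕ, (2 * R) / (ε / 6) < 2 ^ n := pow_unbounded_of_one_lt _ (by norm_num)
    rw [div_lt_iff₀ (by positivity)] at hn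
    have hlow : ∀ y : S, (c ^ n)⁻¹ * μ (ball x R) ≤ μ (ball (y : X) (ε / 6)) := by
      intro y
      have hy : dist x (y : X) ≤ R := by
        have := mem_closedBall'.1 (hSF y.2)
        exact this.trans (le_max_left _ _)
      have := h.ball_le n (x := (y : X)) (y := x) (s := R) (t := ε / 6) (by positivity)
        (by linarith)
      rw [mul_comm, ← div_eq_mul_inv]
      exact ENNReal.div_le_of_le_mul' this
    have hfin := Measure.finite_const_le_meas_of_disjoint_iUnion μ
      (ε := (c ^ n)⁻¹ * μ (ball x R)) (As := fun y : S => ball (y : X) (ε / 6))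
      (by
        refine ENNReal.mul_pos ?_ (h.ball_pos _ _ (by linarith)).ne'
        exact ENNReal.inv_ne_zero.2 (ENNReal.pow_ne_top h.ne_top))
      (fun _ => measurableSet_ball)
      (fun a b hab => hd a.2 b.2 (fun hh => hab (Subtype.ext hh)))
      (by
        refine ne_top_of_le_ne_top (h.ball_ne_top x (3 * R)) (measure_mono ?_)
        refine Set.iUnion_subset fun y => ball_subset_ball' ?_
        have := mem_closedBall.1 (hSF y.2)
        have := le_max_left r ε
        linarith)
    have huniv : (Set.univ : Set S).Finite := hfin.subset fun y _ => hlow y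
    exact Set.finite_coe_iff.1 (Set.finite_univ_iff.1 huniv)
  · obtain ⟨z, hz, hyz⟩ := hcov y hy
    exact Set.mem_biUnion hz (mem_ball.2 (by linarith))

end IsDoublingMeasure

section Geometry

variable {Y : Type*} [MetricSpace Y]

lemma exists_lt_dist {x : Y} {t : ℝ} (ht : ENNReal.ofReal (2 * t) < ediam (Set.univ : Set Y)) :
    ∃ z : Y, t < dist x z := by
  by_contra! hc
  refine ht.not_ge (ediam_le fun a _ b _ => ?_)
  rw [edist_dist]
  refine ENNReal.ofReal_le_ofReal ?_
  have := dist_triangle_left a b x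
  linarith [hc a, hc b]

lemma IsGeodesicSpace.exists_dist_eq (hgeo : IsGeodesicSpace Y) {x : Y} {t : ℝ} (ht0 : 0 ≤ t)
    (ht : ENNReal.ofReal (2 * t) < ediam (Set.univ : Set Y)) : ∃ z : Y, dist x z = t := by
  obtain ⟨w, hw⟩ := exists_lt_dist (x := x) ht
  obtain ⟨γ, h0, -, hγ⟩ := hgeo x w
  refine ⟨γ t, ?_⟩
  have := hγ 0 ⟨le_rfl, dist_nonneg⟩ t ⟨ht0, hw.le⟩
  rw [h0] at this
  rw [this, zero_sub, abs_neg, abs_of_nonneg ht0]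

end Geometry

section Content

variable {μ : Measure X} {c : ℝ≥0∞}

open Filter Topology in
lemma IsQRD.exists_small_ball [Nontrivial X] {σ d : ℝ} {c' : ℝ≥0∞} (hq : IsQRD μ σ c')
    (hc' : c' ≠ ∞) (hfin : ∀ (x : X) (r : ℝ), μ (ball x r) ≠ ∞) (hd : d < σ) (x : X)
    {R : ℝ} (hR : 0 < R) {ε : ℝ≥0∞} (hε : ε ≠ 0) :
    ∃ r : ℝ, 0 < r ∧ r ≤ R ∧ μ (ball x r) * ENNReal.ofReal (r ^ (-d)) ≤ ε := by
  obtain ⟨a, b, hab⟩ := exists_pair_ne X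
  set R' := dist a b with hR'
  have hR'0 : 0 < R' := dist_pos.2 hab
  have hdiam : ENNReal.ofReal R' ≤ 2 * EMetric.diam (Set.univ : Set X) := by
    rw [hR', ← edist_dist]
    refine (edist_le_ediam_of_mem (Set.mem_univ a) (Set.mem_univ b)).trans ?_
    exact le_mul_of_one_le_left (by simp) (by norm_num)
  set A := c' * μ (ball x R') * ENNReal.ofReal (R' ^ (-σ)) with hA
  have hAtop : A ≠ ∞ :=
    ENNReal.mul_ne_top (ENNReal.mul_ne_top hc' (hfin _ _)) ENNReal.ofReal_ne_top
  have hlim : Tendsto (fun r : ℝ => A * ENNReal.ofReal (r ^ (σ - d))) (𝓝[>] 0) (𝓝 0) := by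
    have h1 : Tendsto (fun r : ℝ => r ^ (σ - d)) (𝓝[>] 0) (𝓝 0) := by
      have := (Real.continuousAt_rpow_const 0 (σ - d) (Or.inr (by linarith))).tendsto
      rw [Real.zero_rpow (by linarith)] at this
      exact this.mono_left nhdsWithin_le_nhds
    have h2 := ENNReal.Tendsto.const_mul (a := A) (ENNReal.tendsto_ofReal h1) (Or.inr hAtop)
    simpa using h2
  have hev : ∀ᶠ r : ℝ in 𝓝[>] 0, A * ENNReal.ofReal (r ^ (σ - d)) ≤ ε :=
    hlim.eventually (eventually_le_nhds (pos_iff_ne_zero.2 hε))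
  have hmin : ∀ᶠ r : ℝ in 𝓝[>] 0, r < min R R' :=
    nhdsWithin_le_nhds (eventually_lt_nhds (lt_min hR hR'0))
  obtain ⟨r, ⟨hr1, hr2⟩, hr0⟩ := ((hev.and hmin).and self_mem_nhdsWithin).exists
  have hr0 : 0 < r := hr0
  refine ⟨r, hr0, (hr2.le.trans (min_le_left _ _)), le_trans ?_ hr1⟩
  calc μ (ball x r) * ENNReal.ofReal (r ^ (-d))
      ≤ (c' * ENNReal.ofReal ((r / R') ^ σ) * μ (ball x R')) * ENNReal.ofReal (r ^ (-d)) := by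
        gcongr; exact hq x r R' hr0 (hr2.trans_le (min_le_right _ _)) hdiam
    _ = c' * μ (ball x R') * (ENNReal.ofReal ((r / R') ^ σ) * ENNReal.ofReal (r ^ (-d))) := by ring
    _ = c' * μ (ball x R') *
          (ENNReal.ofReal (R' ^ (-σ)) * ENNReal.ofReal (r ^ (σ - d))) := by
        rw [← ENNReal.ofReal_mul (by positivity), ← ENNReal.ofReal_mul (by positivity)]
        congr 2
        rw [Real.div_rpow hr0.le hR'0.le, Real.rpow_neg hr0.le, Real.rpow_neg hR'0.le,
          Real.rpow_sub hr0]
        field_simp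
    _ = _ := by rw [hA]; ring

/-- Balls of arbitrarily small cost exist at every scale. -/
def HasSmallBalls (μ : Measure X) (d : ℝ) : Prop :=
  ∀ (x : X) (R : ℝ), 0 < R → ∀ ε : ℝ≥0∞, ε ≠ 0 →
    ∃ r : ℝ, 0 < r ∧ r ≤ R ∧ μ (ball x r) * ENNReal.ofReal (r ^ (-d)) ≤ ε

lemma hContent_mono {d : ℝ} {ρ : ℝ≥0∞} {F G : Set X} (h : F ⊆ G) :
    hContent μ d ρ F ≤ hContent μ d ρ G :=
  le_iInf fun ⟨c, hc, hG⟩ => iInf_le_of_le ⟨c, hc, h.trans hG⟩ le_rfl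

lemma hContent_le_tsum {d r : ℝ} (hs : HasSmallBalls μ d) (hr : 0 < r) (x : X)
    {F S : Set X} {ρ : X → ℝ} (hS : S.Countable) (hρ : ∀ y ∈ S, 0 < ρ y ∧ ρ y ≤ r)
    (hF : F ⊆ ⋃ y ∈ S, ball y (ρ y)) :
    hContent μ d (ENNReal.ofReal r) F ≤
      ∑' y : S, μ (ball (y : X) (ρ y)) * ENNReal.ofReal (ρ y ^ (-d)) := by
  classical
  have : Countable S := hS.to_subtype
  obtain ⟨e, he⟩ := Countable.exists_injective_nat S
  refine ENNReal.le_of_forall_pos_le_add fun ε hε _ => ?_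
  obtain ⟨ε', hε'0, hε'⟩ := ENNReal.exists_pos_sum_of_countable
    (ENNReal.coe_ne_zero.2 hε.ne') ℕ
  choose s hs0 hsr hsμ using fun k : ℕ => hs x r hr (ε' k) (ENNReal.coe_ne_zero.2 (hε'0 k).ne')
  set w : S → ℝ≥0∞ := fun y => μ (ball (y : X) (ρ y)) * ENNReal.ofReal (ρ y ^ (-d)) with hw
  let cov : ℕ → X × ℝ := fun k =>
    if h : ∃ y : S, e y = k then ((h.choose : X), ρ h.choose) else (x, s k)
  have hcov : ∀ y : S, cov (e y) = ((y : X), ρ y) := by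
    intro y
    have h : ∃ z : S, e z = e y := ⟨y, rfl⟩
    have : h.choose = y := he h.choose_spec
    simp only [cov, h, dif_pos, this]
  have hcov1 : ∀ k, 0 < (cov k).2 ∧ ENNReal.ofReal (cov k).2 ≤ ENNReal.ofReal r := by
    intro k
    by_cases h : ∃ y : S, e y = k
    · obtain ⟨y, rfl⟩ := h
      rw [hcov]
      exact ⟨(hρ y y.2).1, ENNReal.ofReal_le_ofReal (hρ y y.2).2⟩
    · simp only [cov, h, dif_neg, not_false_iff]
      exact ⟨hs0 k, ENNReal.ofReal_le_ofReal (hsr k)⟩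
  have hcov2 : F ⊆ ⋃ k, ball (cov k).1 (cov k).2 := by
    intro z hz
    obtain ⟨y, hy, hzy⟩ := Set.mem_iUnion₂.1 (hF hz)
    refine Set.mem_iUnion.2 ⟨e ⟨y, hy⟩, ?_⟩
    rw [hcov]
    exact hzy
  refine (iInf_le_of_le ⟨cov, hcov1, hcov2⟩ le_rfl).trans ?_
  · calc ∑' k, μ (ball (cov k).1 (cov k).2) * ENNReal.ofReal ((cov k).2 ^ (-d))
        ≤ ∑' k, ((∑' y : S, if k = e y then w y else 0) + ε' k) := by
          refine ENNReal.tsum_le_tsum fun k => ?_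
          by_cases h : ∃ y : S, e y = k
          · obtain ⟨y, rfl⟩ := h
            rw [hcov]
            refine le_add_right ((le_of_eq ?_).trans (ENNReal.le_tsum y))
            simp [hw]
          · simp only [cov, h, dif_neg, not_false_iff]
            exact le_add_left (hsμ k)
      _ = ∑' y : S, w y + ∑' k, (ε' k : ℝ≥0∞) := by
          rw [ENNReal.tsum_add, ENNReal.tsum_comm]
          simp
      _ ≤ ∑' y : S, w y + ε := by gcongr

lemma IsDoublingMeasure.hContent_closedBall_le (h : IsDoublingMeasure μ c) {d : ℝ}
    (hs : HasSmallBalls μ d) (x : X) {r : ℝ} (hr : 0 < r) :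
    hContent μ d (ENNReal.ofReal r) (closedBall x r) ≤
      c ^ 4 * (μ (ball x r) * ENNReal.ofReal (r ^ (-d))) := by
  obtain ⟨S, hSF, hSc, hd, hcov⟩ := h.exists_covering (F := closedBall x r) (ρ := fun _ => r / 6)
    (x₀ := x) (R := r) subset_rfl (fun y _ => ⟨by positivity, by linarith⟩)
  refine (hContent_le_tsum hs hr x (ρ := fun _ => r) hSc (fun _ _ => ⟨hr, le_rfl⟩)
    fun y hy => ?_).trans ?_
  · obtain ⟨z, hz, hyz⟩ := hcov y hy
    exact Set.mem_biUnion hz (mem_ball.2 (by linarith))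
  · rw [ENNReal.tsum_mul_right, ← mul_assoc]
    gcongr
    calc ∑' y : S, μ (ball (y : X) r) ≤ ∑' y : S, c ^ 3 * μ (ball (y : X) (r / 6)) :=
          ENNReal.tsum_le_tsum fun y => h.ball_le 3 (by positivity) (by
            rw [dist_self]; linarith)
      _ = c ^ 3 * ∑' y : S, μ (ball (y : X) (r / 6)) := ENNReal.tsum_mul_left
      _ ≤ c ^ 3 * μ (ball x (2 * r)) := by
          gcongr
          refine tsum_ball_le hSc hd (fun y hy => ball_subset_ball' ?_) μ
          have := mem_closedBall.1 (hSF hy)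
          linarith
      _ ≤ c ^ 3 * (c * μ (ball x r)) := by gcongr; exact h.doubling x r hr
      _ = c ^ 4 * μ (ball x r) := by ring

lemma le_hContent_of_ball_subset {d : ℝ} (hd : 0 ≤ d) {x : X} {r : ℝ} {F : Set X}
    (hF : ball x r ⊆ F) :
    μ (ball x r) * ENNReal.ofReal (r ^ (-d)) ≤ hContent μ d (ENNReal.ofReal r) F := by
  refine le_iInf fun ⟨cov, hcov, hsub⟩ => ?_
  calc μ (ball x r) * ENNReal.ofReal (r ^ (-d))
      ≤ (∑' k, μ (ball (cov k).1 (cov k).2)) * ENNReal.ofReal (r ^ (-d)) := by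
        gcongr
        exact (measure_mono (hF.trans hsub)).trans (measure_iUnion_le _)
    _ = ∑' k, μ (ball (cov k).1 (cov k).2) * ENNReal.ofReal (r ^ (-d)) :=
        ENNReal.tsum_mul_right.symm
    _ ≤ _ := by
        refine ENNReal.tsum_le_tsum fun k => ?_
        have hk := hcov k
        have hkr : (cov k).2 ≤ r :=
          (ENNReal.ofReal_le_ofReal_iff'.1 hk.2).resolve_right (not_le.2 hk.1)
        have := Real.rpow_le_rpow_of_nonpos hk.1 hkr (neg_nonpos.2 hd)
        gcongr

end Content

section Analytic

lemma setLIntegral_rpow_le {α : Type*} [MeasurableSpace α] {μ : Measure α} {p : ℝ} (hp : 1 < p)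
    {f : α → ℝ≥0∞} (hf : Measurable f) (B : Set α) :
    (∫⁻ x in B, f x ∂μ) ^ p ≤ (∫⁻ x in B, f x ^ p ∂μ) * μ B ^ (p - 1) := by
  have hpq := Real.HolderConjugate.conjExponent hp
  have h := ENNReal.lintegral_mul_le_Lp_mul_Lq (μ.restrict B) hpq hf.aemeasurable
    (g := fun _ => 1) aemeasurable_const
  simp only [Pi.mul_apply, mul_one, ENNReal.one_rpow, lintegral_const, one_mul,
    Measure.restrict_apply_univ] at h
  have hp0 : 0 < p := by linarith
  calc (∫⁻ x in B, f x ∂μ) ^ p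
      ≤ ((∫⁻ x in B, f x ^ p ∂μ) ^ (1 / p) * μ B ^ (1 / p.conjExponent)) ^ p := by gcongr
    _ = _ := by
      rw [ENNReal.mul_rpow_of_nonneg _ _ hp0.le, ← ENNReal.rpow_mul, ← ENNReal.rpow_mul,
        one_div_mul_cancel hp0.ne', ENNReal.rpow_one]
      congr 2
      rw [Real.conjExponent]
      have : p - 1 ≠ 0 := by linarith
      field_simp

lemma ofReal_rpow_mul_measure_le {α : Type*} [MeasurableSpace α] {μ : Measure α} {p β : ℝ}
    (hp : 1 < p) {f : α → ℝ≥0∞} (hf : Measurable f) {B : Set α} (hB0 : μ B ≠ 0) (hB : μ B ≠ ∞)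
    {s t : ℝ} (hs : 0 ≤ s) (ht : 0 < t)
    (h : ENNReal.ofReal s ≤ ENNReal.ofReal (t ^ β) * ((∫⁻ x in B, f x ∂μ) / μ B)) :
    ENNReal.ofReal (s ^ p) * μ B ≤ ENNReal.ofReal (t ^ (β * p)) * ∫⁻ x in B, f x ^ p ∂μ := by
  have hp0 : 0 < p := by linarith
  calc ENNReal.ofReal (s ^ p) * μ B = ENNReal.ofReal s ^ p * μ B := by
        rw [ENNReal.ofReal_rpow_of_nonneg hs hp0.le]
    _ ≤ (ENNReal.ofReal (t ^ β) * ((∫⁻ x in B, f x ∂μ) / μ B)) ^ p * μ B := by gcongr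
    _ = ENNReal.ofReal (t ^ (β * p)) * ((∫⁻ x in B, f x ∂μ) ^ p / μ B ^ p * μ B) := by
        rw [ENNReal.mul_rpow_of_nonneg _ _ hp0.le, ENNReal.ofReal_rpow_of_pos (by positivity),
          ← Real.rpow_mul ht.le, ENNReal.div_rpow_of_nonneg _ _ hp0.le, mul_assoc]
    _ ≤ ENNReal.ofReal (t ^ (β * p)) *
          ((∫⁻ x in B, f x ^ p ∂μ) * μ B ^ (p - 1) / μ B ^ p * μ B) := by
        gcongr; exact setLIntegral_rpow_le hp hf B
    _ = _ := by
        congr 1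
        rw [div_eq_mul_inv, mul_assoc, mul_assoc, ← ENNReal.rpow_neg]
        nth_rw 3 [← ENNReal.rpow_one (μ B)]
        rw [← ENNReal.rpow_add _ _ hB0 hB, ← ENNReal.rpow_add _ _ hB0 hB]
        ring_nf
        simp

/-- If a series is bounded below, some term dominates the corresponding term of a given
geometric series. -/
lemma exists_forall_exists_ofReal_le {C : ℝ≥0∞} (hC : C ≠ ∞) {θ : ℝ} (h0 : 0 < θ) (h1 : θ < 1) :
    ∃ δ : ℝ, 0 < δ ∧ ∀ a : ℕ → ℝ≥0∞, 1 ≤ C * ∑' i, a i →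
      ∃ i, ENNReal.ofReal (δ * θ ^ i) ≤ a i := by
  set K := C.toReal with hK
  have hK0 : 0 ≤ K := ENNReal.toReal_nonneg
  have hθ : 0 < 1 - θ := by linarith
  refine ⟨(1 - θ) / (K + 1), by positivity, fun a ha => ?_⟩
  by_contra! hc
  refine ha.not_gt ?_
  calc C * ∑' i, a i ≤ ENNReal.ofReal K * ∑' i, ENNReal.ofReal ((1 - θ) / (K + 1) * θ ^ i) := by
        rw [hK, ENNReal.ofReal_toReal hC]
        gcongr with i
        exact (hc i).le
    _ = ENNReal.ofReal (K * ((1 - θ) / (K + 1) * (1 - θ)⁻¹)) := by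
        rw [← ENNReal.ofReal_tsum_of_nonneg (fun i => by positivity)
          ((summable_geometric_of_lt_one h0.le h1).mul_left _), tsum_mul_left,
          tsum_geometric_of_lt_one h0.le h1, ← ENNReal.ofReal_mul hK0]
    _ < 1 := by
        rw [ENNReal.ofReal_lt_one, div_mul_eq_mul_div, mul_inv_cancel₀ hθ.ne', mul_one_div,
          div_lt_one (by positivity)]
        linarith

end Analytic
/-- If a discrete fractional potential of `f` is bounded below on `F`, then the Hausdorff content
of `F` is controlled by the `L^p` norm of `f`. -/
lemma IsDoublingMeasure.exists_hContent_le_of_potential {μ : Measure X} {c : ℝ≥0∞}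
    (h : IsDoublingMeasure μ c) {p β d : ℝ} (hp : 1 < p) (hd0 : 0 ≤ d) (hd : d < β * p)
    (hs : HasSmallBalls μ d) {C₀ : ℝ≥0∞} (hC₀ : C₀ ≠ ∞) :
    ∃ C : ℝ≥0∞, C ≠ ∞ ∧ ∀ (x : X) (r : ℝ) (F : Set X) (f : X → ℝ≥0∞), 0 < r → Measurable f →
      F ⊆ closedBall x r →
      (∀ y ∈ F, 1 ≤ C₀ * ∑' i : ℕ, ENNReal.ofReal ((8 * r / 2 ^ i) ^ β) *
        ((∫⁻ z in ball y (8 * r / 2 ^ i), f z ∂μ) / μ (ball y (8 * r / 2 ^ i)))) →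
      hContent μ d (ENNReal.ofReal r) F ≤
        C * ENNReal.ofReal (r ^ (β * p - d)) * ∫⁻ z in ball x (10 * r), f z ^ p ∂μ := by
  have hp0 : 0 < p := by linarith
  set κ := (β * p - d) / p with hκ
  have hκ0 : 0 < κ := div_pos (by linarith) hp0
  have hκp : κ * p = β * p - d := div_mul_cancel₀ _ hp0.ne'
  set θ : ℝ := (1 / 2 : ℝ) ^ κ with hθ
  have hθ0 : 0 < θ := by positivity
  have hθ1 : θ < 1 := Real.rpow_lt_one (by norm_num) (by norm_num) hκ0
  obtain ⟨δ, hδ, hsel⟩ := exists_forall_exists_ofReal_le hC₀ hθ0 hθ1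
  set M : ℝ := δ ^ (-p) * 8 ^ (β * p - d) with hM
  have hM0 : 0 < M := by positivity
  set C : ℝ≥0∞ := c ^ 8 * ENNReal.ofReal (8 ^ d) * ENNReal.ofReal M with hC
  have hCtop : C ≠ ∞ := ENNReal.mul_ne_top (ENNReal.mul_ne_top (ENNReal.pow_ne_top h.ne_top)
    ENNReal.ofReal_ne_top) ENNReal.ofReal_ne_top
  refine ⟨C, hCtop, fun x r F f hr hf hF hpot => ?_⟩
  have hball : ∀ y ∈ F, ∃ ρ : ℝ, 0 < ρ ∧ ρ ≤ 8 * r ∧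
      μ (ball y ρ) * ENNReal.ofReal (ρ ^ (-d)) ≤
        ENNReal.ofReal M * ENNReal.ofReal (r ^ (β * p - d)) * ∫⁻ z in ball y ρ, f z ^ p ∂μ := by
    intro y hy
    obtain ⟨i, hi⟩ := hsel _ (hpot y hy)
    set t := 8 * r / 2 ^ i with ht
    have ht0 : 0 < t := by positivity
    refine ⟨t, ht0, div_le_self (by positivity) (one_le_pow₀ (by norm_num)), ?_⟩
    have key := ofReal_rpow_mul_measure_le hp hf (h.ball_pos y t ht0).ne' (h.ball_ne_top y t)
      (by positivity) ht0 hi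
    have hθi : θ ^ i = (t / (8 * r)) ^ κ := by
      rw [hθ, ← Real.rpow_natCast, ← Real.rpow_mul (by norm_num), mul_comm κ, Real.rpow_mul
        (by norm_num), Real.rpow_natCast, ht]
      congr 1
      field_simp
      rw [← mul_pow]; norm_num
    have hpow : (δ * θ ^ i) ^ p = δ ^ p * (t / (8 * r)) ^ (β * p - d) := by
      rw [Real.mul_rpow hδ.le (by positivity), hθi, ← Real.rpow_mul (by positivity), hκp]
    have hconst : t ^ (-d) / (δ * θ ^ i) ^ p * t ^ (β * p) = M * r ^ (β * p - d) := by
      rw [hpow, hM, Real.div_rpow ht0.le (by positivity), Real.mul_rpow (by norm_num) hr.le,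
        Real.rpow_sub ht0, Real.rpow_neg ht0.le, Real.rpow_neg hδ.le]
      field_simp
    calc μ (ball y t) * ENNReal.ofReal (t ^ (-d))
        = ENNReal.ofReal (t ^ (-d) / (δ * θ ^ i) ^ p) *
            (ENNReal.ofReal ((δ * θ ^ i) ^ p) * μ (ball y t)) := by
          rw [← mul_assoc, ← ENNReal.ofReal_mul (by positivity),
            div_mul_cancel₀ _ (by positivity), mul_comm]
      _ ≤ ENNReal.ofReal (t ^ (-d) / (δ * θ ^ i) ^ p) *
            (ENNReal.ofReal (t ^ (β * p)) * ∫⁻ z in ball y t, f z ^ p ∂μ) := by gcongr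
      _ = _ := by
          rw [← mul_assoc, ← ENNReal.ofReal_mul (by positivity), hconst,
            ENNReal.ofReal_mul hM0.le]
  choose! ρ hρ0 hρ8 hρ using hball
  have hsub : ∀ y ∈ F, ball y (ρ y) ⊆ ball x (10 * r) := fun y hy => by
    refine ball_subset_ball' ?_
    have := mem_closedBall.1 (hF hy)
    linarith [hρ8 y hy]
  by_cases hbig : ∃ y ∈ F, r < 6 * ρ y
  · obtain ⟨y, hy, hry⟩ := hbig
    have hyx := mem_closedBall'.1 (hF hy)
    calc hContent μ d (ENNReal.ofReal r) F
        ≤ c ^ 4 * (μ (ball x r) * ENNReal.ofReal (r ^ (-d))) :=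
          (hContent_mono hF).trans (h.hContent_closedBall_le hs x hr)
      _ ≤ c ^ 4 * ((c ^ 4 * μ (ball y (ρ y))) * ENNReal.ofReal (8 ^ d * ρ y ^ (-d))) := by
          have h1 : r ^ (-d) ≤ 8 ^ d * ρ y ^ (-d) := by
            calc r ^ (-d) ≤ (ρ y / 8) ^ (-d) :=
                  Real.rpow_le_rpow_of_nonpos (by linarith [hρ0 y hy]) (by linarith [hρ8 y hy])
                    (by linarith)
              _ = 8 ^ d * ρ y ^ (-d) := by
                  rw [Real.div_rpow (hρ0 y hy).le (by norm_num),
                    Real.rpow_neg (x := 8) (by norm_num) d, div_inv_eq_mul, mul_comm]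
          gcongr
          exact h.ball_le 4 (hρ0 y hy) (by linarith)
      _ = c ^ 8 * ENNReal.ofReal (8 ^ d) * (μ (ball y (ρ y)) * ENNReal.ofReal (ρ y ^ (-d))) := by
          rw [ENNReal.ofReal_mul (by positivity)]; ring
      _ ≤ c ^ 8 * ENNReal.ofReal (8 ^ d) * (ENNReal.ofReal M *
            ENNReal.ofReal (r ^ (β * p - d)) * ∫⁻ z in ball x (10 * r), f z ^ p ∂μ) := by
          refine mul_le_mul_right ((hρ y hy).trans ?_) _
          exact mul_le_mul_right (lintegral_mono_set (hsub y hy)) _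
      _ = _ := by rw [hC]; ring
  · push Not at hbig
    obtain ⟨S, hSF, hSc, hdisj, hcov⟩ := h.exists_covering (F := F) (ρ := ρ) hF
      (fun y hy => ⟨hρ0 y hy, by linarith [hbig y hy, hρ0 y hy]⟩)
    have hcost : ∀ y : S, μ (ball (y : X) (6 * ρ y)) * ENNReal.ofReal ((6 * ρ y) ^ (-d)) ≤
        c ^ 3 * ENNReal.ofReal M * ENNReal.ofReal (r ^ (β * p - d)) *
          (μ.withDensity fun z => f z ^ p) (ball (y : X) (ρ y)) := by
      intro y
      have hy := hSF y.2
      have hy0 := hρ0 y hy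
      rw [withDensity_apply _ measurableSet_ball]
      calc μ (ball (y : X) (6 * ρ y)) * ENNReal.ofReal ((6 * ρ y) ^ (-d))
          ≤ (c ^ 3 * μ (ball (y : X) (ρ y))) * ENNReal.ofReal (ρ y ^ (-d)) := by
            have h2 : (6 * ρ y) ^ (-d) ≤ ρ y ^ (-d) :=
              Real.rpow_le_rpow_of_nonpos hy0 (by linarith) (by linarith)
            gcongr
            exact h.ball_le 3 hy0 (by rw [dist_self]; linarith)
        _ = c ^ 3 * (μ (ball (y : X) (ρ y)) * ENNReal.ofReal (ρ y ^ (-d))) := by ring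
        _ ≤ _ := mul_le_mul_right (hρ y hy) _
        _ = _ := by ring
    calc hContent μ d (ENNReal.ofReal r) F
        ≤ ∑' y : S, μ (ball (y : X) (6 * ρ y)) * ENNReal.ofReal ((6 * ρ y) ^ (-d)) := by
          refine hContent_le_tsum hs hr x (ρ := fun y => 6 * ρ y) hSc
            (fun y hy => ⟨by linarith [hρ0 y (hSF hy)], hbig y (hSF hy)⟩) fun y hy => ?_
          obtain ⟨z, hz, hyz⟩ := hcov y hy
          exact Set.mem_biUnion hz (mem_ball.2 (by linarith [hρ0 z (hSF hz)]))
      _ ≤ ∑' y : S, c ^ 3 * ENNReal.ofReal M * ENNReal.ofReal (r ^ (β * p - d)) *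
          (μ.withDensity fun z => f z ^ p) (ball (y : X) (ρ y)) := ENNReal.tsum_le_tsum hcost
      _ ≤ c ^ 3 * ENNReal.ofReal M * ENNReal.ofReal (r ^ (β * p - d)) *
          ∫⁻ z in ball x (10 * r), f z ^ p ∂μ := by
          rw [ENNReal.tsum_mul_left]
          gcongr
          refine (tsum_ball_le hSc hdisj (fun y hy => hsub y (hSF hy)) _).trans_eq ?_
          rw [withDensity_apply _ measurableSet_ball]
      _ ≤ _ := by
          rw [hC]
          gcongr ?_ * _ * _
          have h8 : (1 : ℝ≥0∞) ≤ ENNReal.ofReal (8 ^ d) := by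
            rw [← ENNReal.ofReal_one]
            exact ENNReal.ofReal_le_ofReal (Real.one_le_rpow (by norm_num) hd0)
          calc c ^ 3 * ENNReal.ofReal M = c ^ 3 * 1 * ENNReal.ofReal M := by rw [mul_one]
            _ ≤ _ := by
              gcongr
              · exact h.one_le
              · norm_num
lemma le_mul_iInf_of_forall {ι : Sort*} {C a : ℝ≥0∞} {f : ι → ℝ≥0∞} (h0 : C ≠ 0) (htop : C ≠ ∞)
    (h : ∀ i, a ≤ C * f i) : a ≤ C * ⨅ i, f i := by
  rw [ENNReal.mul_iInf_of_ne h0 htop]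
  exact le_iInf h

section RieszLower

variable {μ : Measure X} {c : ℝ≥0∞}

/-- The half-open annulus with outer radius `t` and inner radius `t / 2`. -/
def annulus (y : X) (t : ℝ) : Set X := {z | t / 2 ≤ dist y z ∧ dist y z < t}

lemma measurableSet_annulus (y : X) (t : ℝ) : MeasurableSet (annulus y t) := by
  have : annulus y t = ball y t \ ball y (t / 2) := by
    ext z; simp [annulus, dist_comm z y, and_comm]
  rw [this]; exact measurableSet_ball.diff measurableSet_ball

lemma compl_singleton_subset_annuli (y : X) {R : ℝ} (hR : 0 < R) :
    ({y}ᶜ : Set X) ⊆ (⋃ i : ℕ, annulus y (R / 2 ^ i)) ∪ ⋃ i : ℕ, annulus y (2 ^ (i + 1) * R) := by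
  intro z hz
  have hD : 0 < dist y z := dist_pos.2 (Ne.symm hz)
  obtain ⟨n, hn1, hn2⟩ := exists_mem_Ico_zpow (div_pos hD hR) (one_lt_two (α := ℝ))
  rw [le_div_iff₀ hR] at hn1
  rw [div_lt_iff₀ hR] at hn2
  rcases le_or_gt 0 n with h | h
  · lift n to ℕ using h
    refine Or.inr (Set.mem_iUnion.2 ⟨n, ?_, ?_⟩)
    · rw [zpow_natCast] at hn1
      rw [pow_succ]; linarith
    · exact_mod_cast hn2
  · obtain ⟨i, hi⟩ := Int.eq_ofNat_of_zero_le (a := -(n + 1)) (by lia)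
    obtain rfl : n = -(i : ℤ) - 1 := by lia
    refine Or.inl (Set.mem_iUnion.2 ⟨i, ?_, ?_⟩)
    · rw [zpow_sub₀ two_ne_zero, zpow_neg, zpow_natCast, zpow_one] at hn1
      refine le_trans (le_of_eq ?_) hn1
      field_simp
    · rw [sub_add_cancel, zpow_neg, zpow_natCast] at hn2
      refine lt_of_lt_of_eq hn2 ?_
      field_simp

lemma IsDoublingMeasure.lintegral_annulus_le (h : IsDoublingMeasure μ c) {β : ℝ} (hβ : 0 ≤ β)
    (f : X → ℝ≥0∞) (y : X) {t : ℝ} (ht : 0 < t) :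
    ∫⁻ z in annulus y t, ENNReal.ofReal (dist y z ^ β) / μ (ball y (dist y z))
      ∂(μ.withDensity f) ≤
      c * (ENNReal.ofReal (t ^ β) * ((∫⁻ z in ball y t, f z ∂μ) / μ (ball y t))) := by
  calc ∫⁻ z in annulus y t, ENNReal.ofReal (dist y z ^ β) / μ (ball y (dist y z))
        ∂(μ.withDensity f)
      ≤ ∫⁻ _ in annulus y t, c * (ENNReal.ofReal (t ^ β) / μ (ball y t)) ∂(μ.withDensity f) := by
        refine setLIntegral_mono' (measurableSet_annulus y t) fun z hz => ?_
        have hz0 : 0 ≤ dist y z := dist_nonneg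
        have h1 : μ (ball y t) ≤ c * μ (ball y (dist y z)) := by
          calc μ (ball y t) = μ (ball y (2 * (t / 2))) := by congr 2; ring
            _ ≤ c * μ (ball y (t / 2)) := h.doubling y _ (by positivity)
            _ ≤ _ := by gcongr; exact hz.1
        have h2 : dist y z ^ β ≤ t ^ β := Real.rpow_le_rpow hz0 hz.2.le hβ
        have h3 : (μ (ball y (dist y z)))⁻¹ ≤ c * (μ (ball y t))⁻¹ := by
          rw [← ENNReal.div_eq_inv_mul.trans (mul_comm _ _)]
          rw [ENNReal.le_div_iff_mul_le (Or.inl (h.ball_pos y t ht).ne')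
            (Or.inl (h.ball_ne_top y t)), mul_comm, ← div_eq_mul_inv]
          exact ENNReal.div_le_of_le_mul h1
        rw [div_eq_mul_inv, div_eq_mul_inv, mul_left_comm]
        gcongr
    _ = c * (ENNReal.ofReal (t ^ β) / μ (ball y t)) * (μ.withDensity f) (annulus y t) := by
        rw [setLIntegral_const]
    _ ≤ c * (ENNReal.ofReal (t ^ β) / μ (ball y t)) * ∫⁻ z in ball y t, f z ∂μ := by
        gcongr
        rw [← withDensity_apply _ measurableSet_ball]
        exact measure_mono fun z hz => mem_ball'.2 hz.2
    _ = _ := by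
        simp only [div_eq_mul_inv]; ring

lemma IsDoublingMeasure.exists_hContent_le_rieszCap (h : IsDoublingMeasure μ c)
    {p β σ d : ℝ} {c' : ℝ≥0∞} (hc' : c' ≠ ∞) (hq : IsQRD μ σ c') (hp : 1 < p) (hβ : 0 ≤ β)
    (hσ : β * p < σ) (hd0 : 0 ≤ d) (hd : d < β * p) (hs : HasSmallBalls μ d) :
    ∃ C : ℝ≥0∞, C ≠ ∞ ∧ ∀ (x : X) (r : ℝ) (F : Set X), 0 < r → F ⊆ closedBall x r →
      hContent μ d (ENNReal.ofReal r) F ≤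
        C * ENNReal.ofReal (r ^ (β * p - d)) * rieszCap μ β p F := by
  have hp0 : 0 < p := by linarith
  have hc0 : c ≠ 0 := (zero_lt_one.trans_le h.one_le).ne'
  have h2c : 2 * c ≠ ∞ := ENNReal.mul_ne_top (by simp) h.ne_top
  obtain ⟨C₁, hC₁, hsmall⟩ := h.exists_hContent_le_of_potential hp hd0 hd hs h2c
  set κ := (σ - β * p) / p with hκ
  have hκ0 : 0 < κ := div_pos (by linarith) hp0
  have hκp : κ * p = σ - β * p := div_mul_cancel₀ _ hp0.ne'
  set θ : ℝ := (1 / 2 : ℝ) ^ κ with hθ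
  have hθ0 : 0 < θ := by positivity
  have hθ1 : θ < 1 := Real.rpow_lt_one (by norm_num) (by norm_num) hκ0
  obtain ⟨δ, hδ, hsel⟩ := exists_forall_exists_ofReal_le h2c hθ0 hθ1
  set C₂ : ℝ≥0∞ := c ^ 4 * c' * ENNReal.ofReal (δ ^ (-p) * 8 ^ (β * p)) with hC₂
  have hC₂top : C₂ ≠ ∞ := ENNReal.mul_ne_top (ENNReal.mul_ne_top
    (ENNReal.pow_ne_top h.ne_top) hc') ENNReal.ofReal_ne_top
  refine ⟨C₁ + C₂ + 1, by finiteness, fun x r F hr hF => ?_⟩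
  have hr' : 0 < ENNReal.ofReal (r ^ (β * p - d)) := ENNReal.ofReal_pos.2 (by positivity)
  refine le_mul_iInf_of_forall (mul_ne_zero (by simp) hr'.ne') (by finiteness) ?_
  rintro ⟨f, hf, hpot⟩
  suffices hcase : hContent μ d (ENNReal.ofReal r) F ≤
        C₁ * ENNReal.ofReal (r ^ (β * p - d)) * ∫⁻ z, f z ^ p ∂μ ∨
      hContent μ d (ENNReal.ofReal r) F ≤
        C₂ * ENNReal.ofReal (r ^ (β * p - d)) * ∫⁻ z, f z ^ p ∂μ by
    rcases hcase with hcase | hcase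
    · exact hcase.trans (by gcongr; rw [add_assoc]; exact le_self_add)
    · exact hcase.trans (by gcongr; rw [add_comm C₁, add_assoc]; exact le_self_add)
  have hR : 0 < 8 * r := by positivity
  set I : X → ℕ → ℝ≥0∞ := fun y i => ∫⁻ z in annulus y (2 ^ (i + 1) * (8 * r)),
    ENNReal.ofReal (dist y z ^ β) / μ (ball y (dist y z)) ∂(μ.withDensity f) with hI
  by_cases hall : ∀ y ∈ F, 1 ≤ (2 * c) * ∑' i : ℕ, ENNReal.ofReal ((8 * r / 2 ^ i) ^ β) *
        ((∫⁻ z in ball y (8 * r / 2 ^ i), f z ∂μ) / μ (ball y (8 * r / 2 ^ i)))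
  · left
    exact (hsmall x r F f hr hf hF hall).trans (by gcongr; exact Measure.restrict_le_self)
  · right
    push Not at hall
    obtain ⟨y, hy, hlt⟩ := hall
    have hsum : 1 ≤ (2 * c) * ∑' i, c⁻¹ * I y i := by
      rw [ENNReal.tsum_mul_left, mul_assoc, ← mul_assoc c, ENNReal.mul_inv_cancel hc0 h.ne_top,
        one_mul]
      have hle : rieszPot μ (μ.withDensity f) β y ≤
          c * (∑' i : ℕ, ENNReal.ofReal ((8 * r / 2 ^ i) ^ β) *
            ((∫⁻ z in ball y (8 * r / 2 ^ i), f z ∂μ) / μ (ball y (8 * r / 2 ^ i)))) +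
            ∑' i, I y i := by
        refine (lintegral_mono_set (compl_singleton_subset_annuli y hR)).trans ?_
        refine (lintegral_union_le _ _ _).trans (add_le_add ?_ (lintegral_iUnion_le _ _))
        refine (lintegral_iUnion_le _ _).trans ?_
        rw [← ENNReal.tsum_mul_left]
        exact ENNReal.tsum_le_tsum fun i => h.lintegral_annulus_le hβ f y (by positivity)
      have h1 := (hpot y hy).trans hle
      by_contra! hcon
      rw [mul_assoc] at hlt
      refine absurd h1 (not_le.2 ?_)
      rw [← ENNReal.mul_lt_mul_iff_right (a := 2) (by simp) (by simp), mul_add, mul_one]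
      exact (ENNReal.add_lt_add hlt hcon).trans_eq (by norm_num)
    obtain ⟨i, hi⟩ := hsel _ hsum
    set t := 2 ^ (i + 1) * (8 * r) with ht
    have ht0 : 0 < t := by positivity
    have hne : (annulus y t).Nonempty := by
      by_contra hempty
      rw [Set.not_nonempty_iff_eq_empty] at hempty
      have : I y i = 0 := by simp only [hI, ← ht, hempty, setLIntegral_empty]
      rw [this, mul_zero, nonpos_iff_eq_zero, ENNReal.ofReal_eq_zero] at hi
      exact absurd hi (not_le.2 (by positivity))
    obtain ⟨z, hz, -⟩ := hne
    have hdiam : ENNReal.ofReal t ≤ 2 * EMetric.diam (Set.univ : Set X) := by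
      calc ENNReal.ofReal t ≤ ENNReal.ofReal (2 * dist y z) :=
            ENNReal.ofReal_le_ofReal (by linarith)
        _ = 2 * edist y z := by rw [ENNReal.ofReal_mul (by norm_num), edist_dist]; simp
        _ ≤ _ := by gcongr; exact edist_le_ediam_of_mem (Set.mem_univ y) (Set.mem_univ z)
    have hterm : ENNReal.ofReal (δ * θ ^ (i + 1)) ≤
        ENNReal.ofReal (t ^ β) * ((∫⁻ z in ball y t, f z ∂μ) / μ (ball y t)) := by
      calc ENNReal.ofReal (δ * θ ^ (i + 1)) ≤ ENNReal.ofReal (δ * θ ^ i) := by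
            refine ENNReal.ofReal_le_ofReal ?_
            gcongr δ * ?_
            exact pow_le_pow_of_le_one hθ0.le hθ1.le (Nat.le_succ i)
        _ ≤ c⁻¹ * I y i := hi
        _ ≤ c⁻¹ * (c * _) := by gcongr; exact h.lintegral_annulus_le hβ f y ht0
        _ = _ := by rw [← mul_assoc, ENNReal.inv_mul_cancel hc0 h.ne_top, one_mul]
    have key := ofReal_rpow_mul_measure_le hp hf (h.ball_pos y t ht0).ne' (h.ball_ne_top y t)
      (by positivity) ht0 hterm
    have hRt : 8 * r < t := by
      rw [ht]
      exact lt_mul_of_one_lt_left hR (one_lt_pow₀ (by norm_num) (by lia))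
    have hqy := hq y (8 * r) t hR hRt hdiam
    have hθi : θ ^ (i + 1) = (8 * r / t) ^ κ := by
      rw [hθ, ← Real.rpow_natCast, ← Real.rpow_mul (by norm_num), mul_comm κ, Real.rpow_mul
        (by norm_num), Real.rpow_natCast, ht]
      congr 1
      field_simp
      rw [← mul_pow]; norm_num
    have hpow : (δ * θ ^ (i + 1)) ^ p = δ ^ p * (8 * r / t) ^ (σ - β * p) := by
      rw [Real.mul_rpow hδ.le (by positivity), hθi, ← Real.rpow_mul (by positivity), hκp]
    have hconst : (8 * r / t) ^ σ / (δ * θ ^ (i + 1)) ^ p * t ^ (β * p) =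
        δ ^ (-p) * 8 ^ (β * p) * r ^ (β * p) := by
      rw [hpow, Real.rpow_sub (by positivity), Real.div_rpow hR.le ht0.le (β * p),
        Real.mul_rpow (by norm_num) hr.le, Real.rpow_neg hδ.le]
      have : 0 < (8 * r / t) ^ σ := by positivity
      field_simp
    have hball : μ (ball y (8 * r)) ≤
        c' * ENNReal.ofReal (δ ^ (-p) * 8 ^ (β * p) * r ^ (β * p)) * ∫⁻ z, f z ^ p ∂μ := by
      calc μ (ball y (8 * r)) ≤ c' * ENNReal.ofReal ((8 * r / t) ^ σ) * μ (ball y t) := hqy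
        _ = c' * (ENNReal.ofReal ((8 * r / t) ^ σ / (δ * θ ^ (i + 1)) ^ p) *
              (ENNReal.ofReal ((δ * θ ^ (i + 1)) ^ p) * μ (ball y t))) := by
            rw [← mul_assoc (ENNReal.ofReal _), ← ENNReal.ofReal_mul (by positivity),
              div_mul_cancel₀ _ (by positivity), mul_assoc]
        _ ≤ c' * (ENNReal.ofReal ((8 * r / t) ^ σ / (δ * θ ^ (i + 1)) ^ p) *
              (ENNReal.ofReal (t ^ (β * p)) * ∫⁻ z, f z ^ p ∂μ)) := by
            exact mul_le_mul_right (mul_le_mul_right (key.trans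
              (mul_le_mul_right (setLIntegral_le_lintegral _ _) _)) _) _
        _ = _ := by
            rw [← mul_assoc (ENNReal.ofReal _), ← ENNReal.ofReal_mul (by positivity), hconst,
              ← mul_assoc c']
    have hxy := mem_closedBall'.1 (hF hy)
    calc hContent μ d (ENNReal.ofReal r) F
        ≤ c ^ 4 * (μ (ball x r) * ENNReal.ofReal (r ^ (-d))) :=
          (hContent_mono hF).trans (h.hContent_closedBall_le hs x hr)
      _ ≤ c ^ 4 * (μ (ball y (8 * r)) * ENNReal.ofReal (r ^ (-d))) := by
          gcongr
          exact ball_subset_ball' (by linarith)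
      _ ≤ c ^ 4 * ((c' * ENNReal.ofReal (δ ^ (-p) * 8 ^ (β * p) * r ^ (β * p)) *
            ∫⁻ z, f z ^ p ∂μ) * ENNReal.ofReal (r ^ (-d))) := by gcongr
      _ = C₂ * (ENNReal.ofReal (r ^ (β * p)) * ENNReal.ofReal (r ^ (-d))) *
            ∫⁻ z, f z ^ p ∂μ := by
          rw [ENNReal.ofReal_mul (q := r ^ (β * p)) (by positivity), hC₂]; ring
      _ = _ := by
          rw [← ENNReal.ofReal_mul (by positivity), ← Real.rpow_add hr, ← sub_eq_add_neg]

end RieszLower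

section RelCapLower

variable {μ : Measure X} {c : ℝ≥0∞}

lemma le_lqNorm {q : ℝ≥0∞} (hq : q ≠ 0) (a : ℤ → ℝ≥0∞) (k : ℤ) : a k ≤ lqNorm q a := by
  unfold lqNorm
  split_ifs with h
  · exact le_iSup a k
  · have hq0 : 0 < q.toReal := ENNReal.toReal_pos hq h
    calc a k = (a k ^ q.toReal) ^ (1 / q.toReal) := by
          rw [← ENNReal.rpow_mul, mul_one_div_cancel hq0.ne', ENNReal.rpow_one]
      _ ≤ _ := ENNReal.rpow_le_rpow (ENNReal.le_tsum k) (by positivity)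

lemma exists_mem_diff_le_average {s N : Set X} {G : X → ℝ≥0∞} (hG : Measurable G)
    (h0 : μ s ≠ 0) (htop : μ s ≠ ∞) (hN : μ N = 0) :
    ∃ x ∈ s \ N, G x ≤ (∫⁻ z in s, G z ∂μ) / μ s := by
  have hm : μ (s \ N) = μ s := measure_sdiff_null hN
  obtain ⟨x, hx, hle⟩ := exists_le_setLAverage (μ := μ) (s := s \ N) (f := G) (by rwa [hm])
    (by rwa [hm]) hG.aemeasurable
  rw [setLAverage_eq, hm, setLIntegral_congr (sdiff_null_ae_eq_self hN)] at hle
  exact ⟨x, hx, hle⟩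

/-- Telescoping along averages over shrinking balls. -/
lemma IsDoublingMeasure.one_le_potential (h : IsDoublingMeasure μ c) {β : ℝ} (hβ : 0 ≤ β)
    {x y z : X} {r : ℝ} (hr : 0 < r) (hy : y ∈ closedBall x r) (hz : dist x z = 4 * r)
    {φ : X → ℝ} {G : X → ℝ≥0∞} {N : Set X} (hφ : Continuous φ) (hφy : 1 ≤ φ y)
    (hφ0 : ∀ u ∉ ball x (2 * r), φ u = 0) (hG : Measurable G) (hN : μ N = 0)
    (hφG : ∀ u ∈ ball x (10 * r) \ N, ∀ v ∈ ball x (10 * r) \ N,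
      ENNReal.ofReal |φ u - φ v| ≤ ENNReal.ofReal (dist u v ^ β) * (G u + G v)) :
    1 ≤ (ENNReal.ofReal (2 ^ β) * (c ^ 4 + 1) + ENNReal.ofReal (2 ^ β) +
        ENNReal.ofReal (2 ^ β) * ENNReal.ofReal (2 ^ β)) *
      ∑' i : ℕ, ENNReal.ofReal ((8 * r / 2 ^ i) ^ β) *
        ((∫⁻ z in ball y (8 * r / 2 ^ i), G z ∂μ) / μ (ball y (8 * r / 2 ^ i))) := by
  set D := ENNReal.ofReal (2 ^ β) with hD
  set t : ℕ → ℝ := fun i => 8 * r / 2 ^ i with ht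
  have ht0 : ∀ i, 0 < t i := fun i => by positivity
  have hts : ∀ i, t i = 2 * t (i + 1) := fun i => by
    simp only [ht, pow_succ]; field_simp
  have ht8 : ∀ i, t i ≤ 8 * r := fun i =>
    div_le_self (by positivity) (one_le_pow₀ (by norm_num))
  have htz : t 0 = 8 * r := by simp [ht]
  have hbt : ∀ i, ball y (t i) ⊆ ball x (10 * r) := fun i => by
    refine ball_subset_ball' ?_
    have := mem_closedBall.1 hy
    linarith [ht8 i]
  set A : ℕ → ℝ≥0∞ := fun i => (∫⁻ z in ball y (t i), G z ∂μ) / μ (ball y (t i)) with hA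
  have hex : ∀ i, ∃ u ∈ ball y (t i) \ N, G u ≤ A i := fun i =>
    exists_mem_diff_le_average hG (h.ball_pos _ _ (ht0 i)).ne' (h.ball_ne_top _ _) hN
  choose u hu hGu using hex
  obtain ⟨w, hw, hGw⟩ := exists_mem_diff_le_average (s := ball z r) hG
    (h.ball_pos _ _ hr).ne' (h.ball_ne_top _ _) hN
  have hyx := mem_closedBall'.1 hy
  have hwz := mem_ball.1 hw.1
  have hzy : dist z y ≤ 5 * r := by
    have := dist_triangle_left z y x
    linarith
  have hGw' : G w ≤ c ^ 4 * A 0 := by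
    refine hGw.trans ?_
    have h1 : μ (ball y (t 0)) ≤ c ^ 4 * μ (ball z r) := h.ball_le 4 hr (by
      rw [htz, dist_comm]; linarith)
    have h2 : ball z r ⊆ ball y (t 0) := ball_subset_ball' (by rw [htz]; linarith)
    refine ENNReal.div_le_of_le_mul ?_
    calc ∫⁻ a in ball z r, G a ∂μ ≤ ∫⁻ a in ball y (t 0), G a ∂μ := lintegral_mono_set h2
      _ = A 0 * μ (ball y (t 0)) :=
        (ENNReal.div_mul_cancel (h.ball_pos _ _ (ht0 0)).ne' (h.ball_ne_top _ _)).symm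
      _ ≤ A 0 * (c ^ 4 * μ (ball z r)) := by gcongr
      _ = _ := by ring
  have hstep : ∀ a ∈ ball x (10 * r) \ N, ∀ b ∈ ball x (10 * r) \ N, ∀ s : ℝ, 0 < s →
      dist a b ≤ 2 * s → edist (φ a) (φ b) ≤ D * ENNReal.ofReal (s ^ β) * (G a + G b) := by
    intro a ha b hb s hs hab
    rw [edist_dist, Real.dist_eq]
    refine (hφG a ha b hb).trans ?_
    refine mul_le_mul_left ?_ _
    rw [hD, ← ENNReal.ofReal_mul (by positivity), ← Real.mul_rpow (by norm_num) hs.le]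
    exact ENNReal.ofReal_le_ofReal (Real.rpow_le_rpow dist_nonneg hab hβ)
  have huball : ∀ i, u i ∈ ball x (10 * r) \ N := fun i => ⟨hbt i (hu i).1, (hu i).2⟩
  set a : ℕ → ℝ≥0∞ := fun i => ENNReal.ofReal (t i ^ β) * A i with ha
  have hconsec : ∀ i, edist (φ (u i)) (φ (u i.succ)) ≤ D * a i + D * D * a (i + 1) := by
    intro i
    have h1 := mem_ball.1 (hu i).1
    have h2 := mem_ball.1 (hu (i + 1)).1
    have h3 := dist_triangle_right (u i) (u (i + 1)) y
    have h4 := hts i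
    refine (hstep _ (huball i) _ (huball (i + 1)) (t i) (ht0 i) (by
      linarith [ht0 (i + 1)])).trans ?_
    calc D * ENNReal.ofReal (t i ^ β) * (G (u i) + G (u (i + 1)))
        ≤ D * ENNReal.ofReal (t i ^ β) * (A i + A (i + 1)) := by gcongr <;> exact hGu _
      _ = D * a i + D * (ENNReal.ofReal (t i ^ β) * A (i + 1)) := by rw [ha]; ring
      _ = _ := by
        rw [h4, Real.mul_rpow (by norm_num) (ht0 _).le, ENNReal.ofReal_mul (by positivity), ha]
        ring
  have hlim : Filter.Tendsto (fun i => φ (u i)) Filter.atTop (nhds (φ y)) := by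
    refine (hφ.tendsto y).comp ?_
    rw [tendsto_iff_dist_tendsto_zero]
    refine squeeze_zero (fun _ => dist_nonneg) (fun i => (mem_ball.1 (hu i).1).le) ?_
    have := (tendsto_pow_atTop_nhds_zero_of_lt_one (r := (1 / 2 : ℝ)) (by norm_num)
      (by norm_num)).const_mul (8 * r)
    rw [mul_zero] at this
    refine this.congr fun i => ?_
    simp [ht, div_eq_mul_inv]
  have hsum := edist_le_tsum_of_edist_le_of_tendsto₀ _ hconsec hlim
  have hshift : ∑' i, a (i + 1) ≤ ∑' i, a i :=
    ENNReal.tsum_comp_le_tsum_of_injective (add_left_injective 1) a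
  have hwball : w ∈ ball x (10 * r) := by
    rw [mem_ball]
    have := dist_triangle w z x
    rw [dist_comm z x] at this
    linarith
  have hφw : φ w = 0 := hφ0 w fun hmem => by
    have h1 := mem_ball.1 hmem
    have h2 := dist_triangle_left x z w
    linarith
  have hfirst : edist (φ w) (φ (u 0)) ≤ D * (c ^ 4 + 1) * a 0 := by
    have h1 := mem_ball'.1 (hu 0).1
    have h3 : dist w (u 0) ≤ dist w z + dist z y + dist y (u 0) := dist_triangle4 _ _ _ _
    rw [htz] at h1
    refine (hstep w ⟨hwball, hw.2⟩ _ (huball 0) (t 0) (ht0 0) (by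
      rw [htz]; linarith)).trans ?_
    calc D * ENNReal.ofReal (t 0 ^ β) * (G w + G (u 0))
        ≤ D * ENNReal.ofReal (t 0 ^ β) * (c ^ 4 * A 0 + A 0) := by
          gcongr
          exact hGu 0
      _ = _ := by rw [ha]; ring
  calc (1 : ℝ≥0∞) ≤ edist (φ w) (φ y) := by
        rw [hφw, edist_dist, Real.dist_eq, ← ENNReal.ofReal_one]
        refine ENNReal.ofReal_le_ofReal ?_
        rw [zero_sub, abs_neg]
        exact hφy.trans (le_abs_self _)
    _ ≤ edist (φ w) (φ (u 0)) + edist (φ (u 0)) (φ y) := edist_triangle _ _ _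
    _ ≤ D * (c ^ 4 + 1) * a 0 + ∑' i, (D * a i + D * D * a (i + 1)) := add_le_add hfirst hsum
    _ = D * (c ^ 4 + 1) * a 0 + (D * ∑' i, a i + D * D * ∑' i, a (i + 1)) := by
        rw [ENNReal.tsum_add, ENNReal.tsum_mul_left, ENNReal.tsum_mul_left]
    _ ≤ D * (c ^ 4 + 1) * (∑' i, a i) + (D * ∑' i, a i + D * D * ∑' i, a i) := by
        gcongr
        exact ENNReal.le_tsum 0
    _ = _ := by ring

lemma IsDoublingMeasure.exists_hContent_le_relCap (h : IsDoublingMeasure μ c)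
    (hgeo : IsGeodesicSpace X) {p β d Λ : ℝ} {q : ℝ≥0∞} (hq : q ≠ 0) (hp : 1 < p) (hβ : 0 ≤ β)
    (hd0 : 0 ≤ d) (hd : d < β * p) (hs : HasSmallBalls μ d) (hΛ : 10 ≤ Λ) :
    ∃ C : ℝ≥0∞, C ≠ ∞ ∧ ∀ (x : X) (r : ℝ) (F : Set X), 0 < r →
      ENNReal.ofReal (8 * r) < ediam (Set.univ : Set X) → F ⊆ closedBall x r →
      hContent μ d (ENNReal.ofReal r) F ≤
        C * ENNReal.ofReal (r ^ (β * p - d)) * relCap μ β p q F x r Λ := by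
  have hp0 : 0 < p := by linarith
  set C₀ : ℝ≥0∞ := ENNReal.ofReal (2 ^ β) * (c ^ 4 + 1) + ENNReal.ofReal (2 ^ β) +
    ENNReal.ofReal (2 ^ β) * ENNReal.ofReal (2 ^ β) with hC₀
  have hc4 : c ^ 4 ≠ ∞ := ENNReal.pow_ne_top h.ne_top
  obtain ⟨C, hC, hpot⟩ := h.exists_hContent_le_of_potential hp hd0 hd hs (C₀ := C₀) (by finiteness)
  refine ⟨C + 1, by finiteness, fun x r F hr hdiam hF => ?_⟩
  obtain ⟨z, hz⟩ := hgeo.exists_dist_eq (x := x) (t := 4 * r) (by positivity)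
    (by rwa [← mul_assoc, show (2 : ℝ) * 4 = 8 by norm_num])
  have hr' : 0 < ENNReal.ofReal (r ^ (β * p - d)) := ENNReal.ofReal_pos.2 (by positivity)
  refine le_mul_iInf_of_forall (mul_ne_zero (by simp) hr'.ne') (by finiteness) ?_
  rintro ⟨φ, hφ, hφ1, hφ0⟩
  have hsub : ball x (10 * r) ⊆ ball x (Λ * r) :=
    ball_subset_ball (mul_le_mul_of_nonneg_right hΛ hr.le)
  set K : ℝ≥0∞ := (C + 1) * ENNReal.ofReal (r ^ (β * p - d)) with hK
  have hK0 : K ≠ 0 := mul_ne_zero (by simp) hr'.ne'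
  have hKtop : K ≠ ∞ := by finiteness
  have hmain : ∀ g : {g : ℤ → X → ℝ≥0∞ // IsFracGrad μ β (ball x (Λ * r)) φ g},
      hContent μ d (ENNReal.ofReal r) F ≤ K * mixedNorm μ (ball x (Λ * r)) p q g.1 ^ p := by
    rintro ⟨g, hg, N, -, hN, hφg⟩
    have hG : Measurable fun u => ⨆ k, g k u := Measurable.iSup hg
    have hφG : ∀ u ∈ ball x (10 * r) \ N, ∀ v ∈ ball x (10 * r) \ N,
        ENNReal.ofReal |φ u - φ v| ≤
          ENNReal.ofReal (dist u v ^ β) * ((⨆ k, g k u) + ⨆ k, g k v) := by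
      intro u hu v hv
      rcases eq_or_ne u v with rfl | huv
      · simp
      obtain ⟨n, hn1, hn2⟩ := exists_mem_Ico_zpow (dist_pos.2 huv) (one_lt_two (α := ℝ))
      refine (hφg (-(n + 1)) u ⟨hsub hu.1, hu.2⟩ v ⟨hsub hv.1, hv.2⟩ ?_ ?_).trans ?_
      · rwa [neg_neg, add_sub_cancel_right]
      · rwa [neg_neg]
      · gcongr
        · exact le_iSup (fun k => g k u) _
        · exact le_iSup (fun k => g k v) _
    refine (hpot x r F _ hr hG hF fun y hy => h.one_le_potential hβ hr (hF hy) hz hφ (hφ1 y hy)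
      hφ0 hG hN hφG).trans ?_
    rw [mixedNorm, ← ENNReal.rpow_mul, one_div_mul_cancel hp0.ne', ENNReal.rpow_one, hK]
    gcongr ?_ * _ * ?_
    · exact le_self_add
    · refine (lintegral_mono_set hsub).trans (lintegral_mono fun u => ?_)
      exact ENNReal.rpow_le_rpow (iSup_le fun k => le_lqNorm hq (fun k => g k u) k) hp0.le
  have h1 : (hContent μ d (ENNReal.ofReal r) F / K) ^ (1 / p) ≤
      htlSeminorm μ β p q (ball x (Λ * r)) φ := by
    refine le_iInf fun g => ?_
    rw [one_div, ENNReal.rpow_inv_le_iff hp0]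
    exact ENNReal.div_le_of_le_mul' (hmain g)
  rw [one_div, ENNReal.rpow_inv_le_iff hp0] at h1
  rwa [ENNReal.div_le_iff_le_mul (Or.inl hK0) (Or.inl hKtop), mul_comm] at h1

end RelCapLower
lemma sum_ofReal_geom_rpow_le {x a p : ℝ} (hx : 1 < x) (ha : 0 ≤ a) (hp : 0 < p) (J : Finset ℕ) :
    (∑ j ∈ J, ENNReal.ofReal (a * x ^ j)) ^ p ≤
      ENNReal.ofReal ((x / (x - 1)) ^ p) * ∑ j ∈ J, ENNReal.ofReal ((a * x ^ j) ^ p) := by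
  have hx0 : 0 < x - 1 := by linarith
  have hxx : 0 < x := by linarith
  rcases J.eq_empty_or_nonempty with rfl | hJ
  · simp [hp]
  set m := J.max' hJ with hm
  have hsum : ∑ j ∈ J, a * x ^ j ≤ x / (x - 1) * (a * x ^ m) := by
    calc ∑ j ∈ J, a * x ^ j ≤ ∑ j ∈ Finset.range (m + 1), a * x ^ j := by
          refine Finset.sum_le_sum_of_subset_of_nonneg (fun j hj => ?_)
            (fun j _ _ => by positivity)
          exact Finset.mem_range.2 (Nat.lt_succ_of_le (Finset.le_max' J j hj))
      _ = a * ((x ^ (m + 1) - 1) / (x - 1)) := by rw [← Finset.mul_sum, geom_sum_eq hx.ne']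
      _ ≤ a * (x ^ (m + 1) / (x - 1)) := by gcongr; linarith
      _ = _ := by rw [pow_succ]; ring
  rw [← ENNReal.ofReal_sum_of_nonneg fun j _ => by positivity]
  calc ENNReal.ofReal (∑ j ∈ J, a * x ^ j) ^ p
      ≤ ENNReal.ofReal (x / (x - 1) * (a * x ^ m)) ^ p := by gcongr
    _ = ENNReal.ofReal ((x / (x - 1)) ^ p) * ENNReal.ofReal ((a * x ^ m) ^ p) := by
        rw [ENNReal.ofReal_rpow_of_nonneg (by positivity) hp.le,
          Real.mul_rpow (by positivity) (by positivity), ENNReal.ofReal_mul (by positivity)]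
    _ ≤ _ := by
        gcongr
        exact Finset.single_le_sum (f := fun j => ENNReal.ofReal ((a * x ^ j) ^ p))
          (fun _ _ => zero_le) (Finset.max'_mem J hJ)

/-- The sum over the dyadic scales `r / 2 ^ j`, `1 ≤ j ≤ k`, of the normalized indicators of the
neighbourhoods of `F`. -/
def multiscale (β r : ℝ) (k : ℕ) (F : Set X) (y : X) : ℝ≥0∞ :=
  ∑ j ∈ Finset.Icc 1 k, ENNReal.ofReal ((r / 2 ^ j) ^ (-β)) *
    (thickening (r / 2 ^ j) F).indicator (fun _ => 1) y

section Upper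

variable {μ : Measure X} {c : ℝ≥0∞}

lemma measurable_multiscale (β r : ℝ) (k : ℕ) (F : Set X) : Measurable (multiscale β r k F) :=
  Finset.measurable_fun_sum _ fun _ _ =>
    (measurable_const.indicator isOpen_thickening.measurableSet).const_mul _

lemma exists_lintegral_multiscale_le {β p : ℝ} (hβ : 0 < β) (hp : 0 < p) :
    ∃ C : ℝ≥0∞, C ≠ ∞ ∧ ∀ (μ : Measure X) (r : ℝ) (k : ℕ) (F : Set X), 0 < r →
      ∫⁻ y, multiscale β r k F y ^ p ∂μ ≤ C * ∑ j ∈ Finset.Icc 1 k,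
        ENNReal.ofReal ((r / 2 ^ j) ^ (-(β * p))) * μ (thickening (r / 2 ^ j) F) := by
  have hx : (1 : ℝ) < 2 ^ β := Real.one_lt_rpow (by norm_num) hβ
  refine ⟨ENNReal.ofReal (((2 : ℝ) ^ β / (2 ^ β - 1)) ^ p), ENNReal.ofReal_ne_top,
    fun μ r k F hr => ?_⟩
  have hb : ∀ j : ℕ, (r / 2 ^ j) ^ (-β) = r ^ (-β) * ((2 : ℝ) ^ β) ^ j := fun j => by
    rw [Real.div_rpow hr.le (by positivity), Real.rpow_neg (x := (2 : ℝ) ^ j) (by positivity),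
      ← Real.rpow_natCast, ← Real.rpow_natCast, ← Real.rpow_mul (by norm_num),
      ← Real.rpow_mul (by norm_num), mul_comm β, div_inv_eq_mul]
  have hbp : ∀ j : ℕ, (r / 2 ^ j) ^ (-(β * p)) = (r ^ (-β) * ((2 : ℝ) ^ β) ^ j) ^ p := fun j => by
    rw [← hb, ← Real.rpow_mul (by positivity), neg_mul]
  calc ∫⁻ y, multiscale β r k F y ^ p ∂μ
      ≤ ∫⁻ y, ENNReal.ofReal (((2 : ℝ) ^ β / (2 ^ β - 1)) ^ p) * ∑ j ∈ Finset.Icc 1 k,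
          ENNReal.ofReal ((r / 2 ^ j) ^ (-(β * p))) *
            (thickening (r / 2 ^ j) F).indicator (fun _ => 1) y ∂μ := by
        classical
        refine lintegral_mono fun y => ?_
        have key := sum_ofReal_geom_rpow_le hx (Real.rpow_nonneg hr.le (-β)) hp
          ((Finset.Icc 1 k).filter fun j => y ∈ thickening (r / 2 ^ j) F)
        rw [Finset.sum_filter, Finset.sum_filter] at key
        simp only [multiscale, Set.indicator_apply, mul_ite, mul_one, mul_zero, hb, hbp]
        exact key
    _ = _ := by
        rw [lintegral_const_mul _ (Finset.measurable_fun_sum _ fun _ _ =>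
          (measurable_const.indicator isOpen_thickening.measurableSet).const_mul _),
          lintegral_finsetSum _ fun _ _ =>
          (measurable_const.indicator isOpen_thickening.measurableSet).const_mul _]
        congr 1
        refine Finset.sum_congr rfl fun j _ => ?_
        rw [lintegral_const_mul _ (measurable_const.indicator isOpen_thickening.measurableSet),
          lintegral_indicator isOpen_thickening.measurableSet, setLIntegral_one]

lemma IsDoublingMeasure.measure_ball_le_annulus (h : IsDoublingMeasure μ c)
    (hgeo : IsGeodesicSpace X) {y : X} {t : ℝ} (ht : 0 < t)
    (hdiam : ENNReal.ofReal (2 * t) < ediam (Set.univ : Set X)) :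
    μ (ball y t) ≤ c ^ 4 * μ (annulus y t) := by
  obtain ⟨z, hz⟩ := hgeo.exists_dist_eq (x := y) (t := 3 * t / 4) (by positivity)
    ((ENNReal.ofReal_le_ofReal (by linarith)).trans_lt hdiam)
  refine (h.ball_le 4 (x := z) (t := t / 8) (by positivity) (by linarith)).trans ?_
  refine mul_le_mul_right (measure_mono fun w hw => ?_) _
  have h1 := mem_ball.1 hw
  have h2 := dist_triangle y z w
  have h3 := dist_triangle_right y z w
  rw [dist_comm] at h1
  exact ⟨by linarith, by linarith⟩

lemma IsDoublingMeasure.exists_rieszCap_le (h : IsDoublingMeasure μ c)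
    (hgeo : IsGeodesicSpace X) {β p : ℝ} (hβ : 0 < β) (hp : 0 < p) :
    ∃ C : ℝ≥0∞, C ≠ ∞ ∧ ∀ (r : ℝ) (F : Set X) (k : ℕ), 0 < r → 1 ≤ k →
      ENNReal.ofReal (2 * r) < ediam (Set.univ : Set X) →
      rieszCap μ β p F ≤ C * ENNReal.ofReal ((k : ℝ) ^ (-p)) * ∑ j ∈ Finset.Icc 1 k,
        ENNReal.ofReal ((r / 2 ^ j) ^ (-(β * p))) * μ (thickening (r / 2 ^ j) F) := by
  obtain ⟨C, hC, hmulti⟩ := exists_lintegral_multiscale_le (X := X) hβ hp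
  set A : ℝ≥0∞ := ENNReal.ofReal (2 ^ β) * c ^ 4 with hA
  have hc4 : c ^ 4 ≠ ∞ := ENNReal.pow_ne_top h.ne_top
  have hAtop : A ≠ ∞ := by finiteness
  refine ⟨A ^ p * C, by finiteness, fun r F k hr hk hdiam => ?_⟩
  have hk0 : (0 : ℝ) < k := by exact_mod_cast hk
  set a : ℝ≥0∞ := A * ENNReal.ofReal ((k : ℝ)⁻¹) with ha
  have hatop : a ≠ ∞ := by finiteness
  have hap : a ^ p = A ^ p * ENNReal.ofReal ((k : ℝ) ^ (-p)) := by
    rw [ha, ENNReal.mul_rpow_of_nonneg _ _ hp.le,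
      ENNReal.ofReal_rpow_of_nonneg (by positivity) hp.le, Real.inv_rpow hk0.le,
      Real.rpow_neg hk0.le]
  set f : X → ℝ≥0∞ := fun y => a * multiscale β r k F y with hf
  have hfm : Measurable f := (measurable_multiscale β r k F).const_mul _
  have hpot : ∀ x ∈ F, 1 ≤ rieszPot μ (μ.withDensity f) β x := by
    intro x hx
    have hsub : (⋃ j ∈ Finset.Icc 1 k, annulus x (r / 2 ^ j)) ⊆ {x}ᶜ := by
      refine Set.iUnion₂_subset fun j _ z hz hzx => ?_
      have h1 := hz.1
      rw [Set.mem_singleton_iff.1 hzx, dist_self] at h1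
      have : 0 < r / 2 ^ j := by positivity
      linarith
    have hdisj : (↑(Finset.Icc 1 k) : Set ℕ).PairwiseDisjoint fun j => annulus x (r / 2 ^ j) := by
      have hlt : ∀ i j : ℕ, i < j → Disjoint (annulus x (r / 2 ^ i)) (annulus x (r / 2 ^ j)) := by
        intro i j hij
        refine Set.disjoint_left.2 fun z hz hz' => ?_
        have h1 : r / 2 ^ j ≤ r / 2 ^ (i + 1) := by
          gcongr
          · norm_num
          · exact hij
        have h2 : r / 2 ^ (i + 1) = r / 2 ^ i / 2 := by rw [pow_succ]; field_simp
        linarith [hz.1, hz'.2]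
      intro i _ j _ hij
      rcases hij.lt_or_gt with hij | hij
      · exact hlt i j hij
      · exact (hlt j i hij).symm
    have hterm : ∀ j ∈ Finset.Icc 1 k, ENNReal.ofReal ((k : ℝ)⁻¹) ≤
        ∫⁻ y in annulus x (r / 2 ^ j),
          ENNReal.ofReal (dist x y ^ β) / μ (ball x (dist x y)) ∂(μ.withDensity f) := by
      intro j hj
      set t := r / 2 ^ j with ht
      have ht0 : 0 < t := by positivity
      have htr : t ≤ r := div_le_self hr.le (one_le_pow₀ (by norm_num))
      have hm0 := (h.ball_pos x t ht0).ne'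
      have hmt := h.ball_ne_top x t
      have hann := h.measure_ball_le_annulus hgeo (y := x) ht0
        ((ENNReal.ofReal_le_ofReal (by linarith)).trans_lt hdiam)
      have hfge : ∀ y ∈ annulus x t, a * ENNReal.ofReal (t ^ (-β)) ≤ f y := by
        intro y hy
        refine mul_le_mul_right ?_ _
        have hy' : y ∈ thickening t F := mem_thickening_iff.2 ⟨x, hx, by
          rw [dist_comm]; exact hy.2⟩
        refine le_trans (le_of_eq ?_) (Finset.single_le_sum (f := fun j =>
          ENNReal.ofReal ((r / 2 ^ j) ^ (-β)) * (thickening (r / 2 ^ j) F).indicator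
            (fun _ => (1 : ℝ≥0∞)) y) (fun _ _ => zero_le) hj)
        rw [← ht, Set.indicator_of_mem hy', mul_one]
      calc ENNReal.ofReal ((k : ℝ)⁻¹)
          = ENNReal.ofReal ((t / 2) ^ β) * (μ (ball x t))⁻¹ *
              (A * c⁻¹ ^ 4 * ENNReal.ofReal ((k : ℝ)⁻¹) * ENNReal.ofReal (t ^ (-β)) *
                μ (ball x t)) := by
            have h1 : ENNReal.ofReal ((t / 2) ^ β) * ENNReal.ofReal (t ^ (-β)) *
                ENNReal.ofReal (2 ^ β) = 1 := by
              rw [← ENNReal.ofReal_mul (by positivity), ← ENNReal.ofReal_mul (by positivity),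
                Real.div_rpow ht0.le (by norm_num), Real.rpow_neg ht0.le]
              rw [← ENNReal.ofReal_one]
              congr 1
              field_simp
            have h2 : (μ (ball x t))⁻¹ * μ (ball x t) = 1 := ENNReal.inv_mul_cancel hm0 hmt
            have h3 : c ^ 4 * c⁻¹ ^ 4 = 1 := by
              rw [← mul_pow, ENNReal.mul_inv_cancel (zero_lt_one.trans_le h.one_le).ne' h.ne_top,
                one_pow]
            calc ENNReal.ofReal ((k : ℝ)⁻¹)
                = (ENNReal.ofReal ((t / 2) ^ β) * ENNReal.ofReal (t ^ (-β)) *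
                    ENNReal.ofReal (2 ^ β)) * ((μ (ball x t))⁻¹ * μ (ball x t)) *
                    (c ^ 4 * c⁻¹ ^ 4) * ENNReal.ofReal ((k : ℝ)⁻¹) := by
                  rw [h1, h2, h3, one_mul, one_mul, one_mul]
              _ = _ := by rw [hA]; ring
        _ ≤ ENNReal.ofReal ((t / 2) ^ β) * (μ (ball x t))⁻¹ *
              (a * ENNReal.ofReal (t ^ (-β)) * μ (annulus x t)) := by
            have h4 : c⁻¹ ^ 4 * μ (ball x t) ≤ μ (annulus x t) := by
              rw [← ENNReal.inv_pow, mul_comm, ← div_eq_mul_inv]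
              exact ENNReal.div_le_of_le_mul' hann
            refine mul_le_mul_right ?_ _
            calc A * c⁻¹ ^ 4 * ENNReal.ofReal ((k : ℝ)⁻¹) * ENNReal.ofReal (t ^ (-β)) *
                μ (ball x t) = a * ENNReal.ofReal (t ^ (-β)) * (c⁻¹ ^ 4 * μ (ball x t)) := by
                  rw [ha]; ring
              _ ≤ _ := mul_le_mul_right h4 _
        _ ≤ ENNReal.ofReal ((t / 2) ^ β) * (μ (ball x t))⁻¹ *
              (μ.withDensity f) (annulus x t) := by
            refine mul_le_mul_right ?_ _
            rw [withDensity_apply _ (measurableSet_annulus x t), ← setLIntegral_const]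
            exact setLIntegral_mono hfm hfge
        _ ≤ _ := by
            rw [← setLIntegral_const]
            refine setLIntegral_mono' (measurableSet_annulus x t) fun y hy => ?_
            rw [div_eq_mul_inv]
            refine mul_le_mul' (ENNReal.ofReal_le_ofReal (Real.rpow_le_rpow (by positivity) hy.1
              hβ.le)) (ENNReal.inv_le_inv.2 (measure_mono (ball_subset_ball hy.2.le)))
    calc (1 : ℝ≥0∞) = ∑ _j ∈ Finset.Icc 1 k, ENNReal.ofReal ((k : ℝ)⁻¹) := by
          rw [Finset.sum_const, Nat.card_Icc, Nat.add_sub_cancel, nsmul_eq_mul,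
            ← ENNReal.ofReal_natCast, ← ENNReal.ofReal_mul hk0.le, mul_inv_cancel₀ hk0.ne',
            ENNReal.ofReal_one]
      _ ≤ _ := Finset.sum_le_sum hterm
      _ = ∫⁻ y in ⋃ j ∈ Finset.Icc 1 k, annulus x (r / 2 ^ j),
          ENNReal.ofReal (dist x y ^ β) / μ (ball x (dist x y)) ∂(μ.withDensity f) :=
          (lintegral_biUnion_finset hdisj (fun _ _ => measurableSet_annulus x _) _).symm
      _ ≤ _ := lintegral_mono_set hsub
  calc rieszCap μ β p F ≤ ∫⁻ y, f y ^ p ∂μ := iInf_le (fun f : {f : X → ℝ≥0∞ // Measurable f ∧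
          ∀ x ∈ F, 1 ≤ rieszPot μ (μ.withDensity f) β x} => ∫⁻ x, f.1 x ^ p ∂μ) ⟨f, hfm, hpot⟩
    _ = a ^ p * ∫⁻ y, multiscale β r k F y ^ p ∂μ := by
        rw [← lintegral_const_mul _ ((measurable_multiscale β r k F).pow_const p)]
        simp only [hf, ENNReal.mul_rpow_of_nonneg _ _ hp.le]
    _ ≤ a ^ p * (C * _) := mul_le_mul_right (hmulti μ r k F hr) _
    _ = _ := by rw [hap]; ring

end Upper

section RelCapUpper

lemma lqNorm_le_tsum {q : ℝ≥0∞} (hq : 1 ≤ q) (a : ℤ → ℝ≥0∞) : lqNorm q a ≤ ∑' k, a k := by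
  unfold lqNorm
  split_ifs with h
  · exact iSup_le fun k => ENNReal.le_tsum k
  · have hq1 : 1 ≤ q.toReal := by
      rw [← ENNReal.toReal_one]
      exact (ENNReal.toReal_le_toReal (by simp) h).2 hq
    have hpow : ∀ x : ℝ≥0∞, x ^ q.toReal = x * x ^ (q.toReal - 1) := fun x => by
      rw [← add_sub_cancel 1 q.toReal, ENNReal.rpow_add_of_nonneg _ _ zero_le_one (by linarith),
        ENNReal.rpow_one, add_sub_cancel_left]
    rw [one_div, ENNReal.rpow_inv_le_iff (by linarith), hpow, ← ENNReal.tsum_mul_right]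
    refine ENNReal.tsum_le_tsum fun k => ?_
    rw [hpow]
    exact mul_le_mul_right (ENNReal.rpow_le_rpow (ENNReal.le_tsum k) (by linarith)) _

/-- Summable weights over the dyadic scales, comparing a Lipschitz bound at scale `t` with a
Hölder bound. -/
lemma exists_scale_weights {β : ℝ} (hβ0 : 0 < β) (hβ1 : β < 1) :
    ∃ C : ℝ≥0∞, C ≠ ∞ ∧ ∀ t : ℝ, 0 < t → ∃ w : ℤ → ℝ≥0∞, ∑' n, w n ≤ C ∧
      ∀ (n : ℤ) (D : ℝ), (2 : ℝ) ^ (-n - 1) ≤ D → D < (2 : ℝ) ^ (-n) →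
        ENNReal.ofReal (min 1 (D / t)) ≤
          ENNReal.ofReal (D ^ β) * (ENNReal.ofReal (t ^ (-β)) * w n) := by
  set θ : ℝ := max (2 ^ (-β)) (2 ^ (-(1 - β))) with hθ
  have hθ0 : 0 < θ := lt_max_of_lt_left (by positivity)
  have hθ1 : θ < 1 := max_lt (Real.rpow_lt_one_of_one_lt_of_neg (by norm_num) (by linarith))
    (Real.rpow_lt_one_of_one_lt_of_neg (by norm_num) (by linarith))
  set W : ℤ → ℝ≥0∞ := fun n => ENNReal.ofReal (2 * θ ^ n.natAbs) with hW
  have hsum : Summable fun n : ℤ => 2 * θ ^ n.natAbs := by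
    refine Summable.mul_left _ (Summable.of_nat_of_neg ?_ ?_) <;>
      simpa using summable_geometric_of_lt_one hθ0.le hθ1
  refine ⟨∑' n, W n, hsum.tsum_ofReal_ne_top, fun t ht => ?_⟩
  obtain ⟨m, hm1, hm2⟩ := exists_mem_Ico_zpow (inv_pos.2 ht) (one_lt_two (α := ℝ))
  refine ⟨fun n => W (n - m), ((Equiv.subRight m).tsum_eq W).le, fun n D hD1 hD2 => ?_⟩
  have hD0 : 0 < D := lt_of_lt_of_le (by positivity) hD1
  have hDt : 0 < D / t := by positivity
  suffices hreal : min 1 (D / t) ≤ (D / t) ^ β * (2 * θ ^ (n - m).natAbs) by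
    rw [← ENNReal.ofReal_mul (by positivity), ← ENNReal.ofReal_mul (by positivity)]
    refine ENNReal.ofReal_le_ofReal (hreal.trans_eq ?_)
    rw [Real.div_rpow hD0.le ht.le, Real.rpow_neg ht.le]
    ring
  rcases le_or_gt m n with hmn | hmn
  · obtain ⟨i, rfl⟩ := Int.le.dest hmn
    have hi : (m + (i : ℤ) - m).natAbs = i := by simp
    have h1 : D / t ≤ 2 * (1 / 2) ^ i := by
      rw [div_eq_mul_inv]
      calc D * t⁻¹ ≤ (2 : ℝ) ^ (-(m + (i : ℤ))) * 2 ^ (m + 1) := by gcongr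
        _ = _ := by
          rw [← zpow_add₀ two_ne_zero, show -(m + (i : ℤ)) + (m + 1) = 1 + -(i : ℤ) by ring,
            zpow_add₀ two_ne_zero, zpow_one, zpow_neg, zpow_natCast]
          simp
    have h2 : (D / t) ^ (1 - β) ≤ 2 * θ ^ i := by
      calc (D / t) ^ (1 - β) ≤ (2 * (1 / 2) ^ i) ^ (1 - β) :=
            Real.rpow_le_rpow hDt.le h1 (by linarith)
        _ = 2 ^ (1 - β) * ((1 / 2 : ℝ) ^ (1 - β)) ^ i := by
            rw [Real.mul_rpow (by norm_num) (by positivity), ← Real.rpow_natCast,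
              ← Real.rpow_natCast, ← Real.rpow_mul (by norm_num), ← Real.rpow_mul (by norm_num),
              mul_comm (i : ℝ)]
        _ ≤ 2 * θ ^ i := by
            have h3 : (2 : ℝ) ^ (1 - β) ≤ 2 := by
              calc (2 : ℝ) ^ (1 - β) ≤ 2 ^ (1 : ℝ) :=
                    Real.rpow_le_rpow_of_exponent_le (by norm_num) (by linarith)
                _ = 2 := Real.rpow_one 2
            have h4 : (1 / 2 : ℝ) ^ (1 - β) ≤ θ := by
              rw [one_div, Real.inv_rpow (by norm_num), ← Real.rpow_neg (by norm_num)]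
              exact le_max_right _ _
            gcongr
    rw [hi]
    calc min 1 (D / t) ≤ D / t := min_le_right _ _
      _ = (D / t) ^ β * (D / t) ^ (1 - β) := by
          rw [← Real.rpow_add hDt, add_sub_cancel, Real.rpow_one]
      _ ≤ _ := by gcongr
  · obtain ⟨i, hi⟩ := Int.le.dest hmn.le
    have hi' : (n - m).natAbs = i := by lia
    have h1 : 2 ^ i / 2 ≤ D / t := by
      calc (2 : ℝ) ^ i / 2 = (2 : ℝ) ^ (-n - 1) * 2 ^ m := by
            rw [← zpow_add₀ two_ne_zero, ← hi, show -n - 1 + (n + (i : ℤ)) = (i : ℤ) - 1 by ring,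
              zpow_sub₀ two_ne_zero, zpow_natCast, zpow_one]
        _ ≤ D * t⁻¹ := by gcongr
        _ = _ := (div_eq_mul_inv _ _).symm
    have h2 : (D / t) ^ (-β) ≤ 2 * θ ^ i := by
      calc (D / t) ^ (-β) ≤ (2 ^ i / 2) ^ (-β) :=
            Real.rpow_le_rpow_of_nonpos (by positivity) h1 (by linarith)
        _ = 2 ^ β * ((2 : ℝ) ^ (-β)) ^ i := by
            rw [Real.div_rpow (by positivity) (by norm_num), Real.rpow_neg (x := 2) (by norm_num) β,
              div_inv_eq_mul, ← Real.rpow_neg (by norm_num), ← Real.rpow_natCast,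
              ← Real.rpow_natCast, ← Real.rpow_mul (by norm_num), ← Real.rpow_mul (by norm_num),
              mul_comm (i : ℝ), mul_comm]
        _ ≤ 2 * θ ^ i := by
            have h3 : (2 : ℝ) ^ β ≤ 2 := by
              calc (2 : ℝ) ^ β ≤ 2 ^ (1 : ℝ) :=
                    Real.rpow_le_rpow_of_exponent_le (by norm_num) (by linarith)
                _ = 2 := Real.rpow_one 2
            gcongr
            exact le_max_left _ _
    rw [hi']
    calc min 1 (D / t) ≤ 1 := min_le_left _ _
      _ = (D / t) ^ β * (D / t) ^ (-β) := by
          rw [← Real.rpow_add hDt, add_neg_cancel, Real.rpow_zero]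
      _ ≤ _ := by gcongr

/-- The cutoff function equal to `1` on `F` and vanishing at distance at least `t` from `F`. -/
def cutoff (F : Set X) (t : ℝ) (y : X) : ℝ := max 0 (1 - infDist y F / t)

lemma continuous_cutoff (F : Set X) (t : ℝ) : Continuous (cutoff F t) :=
  continuous_const.max (continuous_const.sub ((continuous_infDist_pt F).div_const t))

lemma cutoff_eq_zero {F : Set X} {t : ℝ} {y : X} (ht : 0 < t) (h : t ≤ infDist y F) :
    cutoff F t y = 0 :=
  max_eq_left (by rw [sub_nonpos, le_div_iff₀ ht, one_mul]; exact h)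

lemma cutoff_eq_one {F : Set X} {t : ℝ} {y : X} (h : y ∈ F) : cutoff F t y = 1 := by
  simp [cutoff, infDist_zero_of_mem h]

lemma abs_cutoff_sub_le {F : Set X} {t : ℝ} (hF : F.Nonempty) (ht : 0 < t) (u v : X) :
    ENNReal.ofReal |cutoff F t u - cutoff F t v| ≤ ENNReal.ofReal (min 1 (dist u v / t)) *
      ((thickening t F).indicator (fun _ => 1) u + (thickening t F).indicator (fun _ => 1) v) := by
  by_cases huv : u ∈ thickening t F ∨ v ∈ thickening t F
  · have h1 : (1 : ℝ≥0∞) ≤ (thickening t F).indicator (fun _ => 1) u +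
        (thickening t F).indicator (fun _ => 1) v := by
      rcases huv with hu | hv
      · rw [Set.indicator_of_mem hu]; exact le_self_add
      · rw [Set.indicator_of_mem hv]; exact le_add_self
    refine le_trans ?_ (mul_le_mul_right h1 _)
    rw [mul_one]
    refine ENNReal.ofReal_le_ofReal (le_min ?_ ?_)
    · have hmem : ∀ w, 0 ≤ cutoff F t w ∧ cutoff F t w ≤ 1 := fun w =>
        ⟨le_max_left _ _, max_le zero_le_one (by
          have : 0 ≤ infDist w F / t := div_nonneg infDist_nonneg ht.le
          linarith)⟩
      rw [abs_le]
      constructor <;> linarith [(hmem u).1, (hmem v).1, (hmem u).2, (hmem v).2]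
    · have h2 := (lipschitz_infDist_pt F).dist_le_mul u v
      rw [NNReal.coe_one, one_mul, Real.dist_eq] at h2
      have h3 := abs_max_sub_max_le_max 0 (1 - infDist u F / t) 0 (1 - infDist v F / t)
      have h4 := max_eq_right (abs_nonneg ((1 - infDist u F / t) - (1 - infDist v F / t)))
      rw [sub_self, abs_zero, h4] at h3
      refine h3.trans ?_
      rw [sub_sub_sub_cancel_left, ← sub_div, abs_div, abs_of_pos ht, abs_sub_comm]
      gcongr
  · push Not at huv
    rw [mem_thickening_iff_infDist_lt hF, mem_thickening_iff_infDist_lt hF, not_lt, not_lt] at huv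
    rw [cutoff_eq_zero ht huv.1, cutoff_eq_zero ht huv.2]
    simp

lemma exists_relCap_le (μ : Measure X) {β p : ℝ} {q : ℝ≥0∞} (hq : 1 ≤ q) (hβ0 : 0 < β)
    (hβ1 : β < 1) (hp : 0 < p) (Λ : ℝ) :
    ∃ C : ℝ≥0∞, C ≠ ∞ ∧ ∀ (x : X) (r : ℝ) (F : Set X) (k : ℕ), 0 < r → 1 ≤ k → F.Nonempty →
      F ⊆ closedBall x r →
      relCap μ β p q F x r Λ ≤ C * ENNReal.ofReal ((k : ℝ) ^ (-p)) * ∑ j ∈ Finset.Icc 1 k,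
        ENNReal.ofReal ((r / 2 ^ j) ^ (-(β * p))) * μ (thickening (r / 2 ^ j) F) := by
  obtain ⟨C, hC, hmulti⟩ := exists_lintegral_multiscale_le (X := X) hβ0 hp
  obtain ⟨A, hA, hw⟩ := exists_scale_weights hβ0 hβ1
  refine ⟨A ^ p * C, by finiteness, fun x r F k hr hk hFne hF => ?_⟩
  have hk0 : (0 : ℝ) < k := by exact_mod_cast hk
  have ht : ∀ j : ℕ, 0 < r / 2 ^ j := fun j => by positivity
  have hex : ∀ j : ℕ, ∃ w : ℤ → ℝ≥0∞, ∑' n, w n ≤ A ∧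
      ∀ (n : ℤ) (D : ℝ), (2 : ℝ) ^ (-n - 1) ≤ D → D < (2 : ℝ) ^ (-n) →
        ENNReal.ofReal (min 1 (D / (r / 2 ^ j))) ≤
          ENNReal.ofReal (D ^ β) * (ENNReal.ofReal ((r / 2 ^ j) ^ (-β)) * w n) :=
    fun j => hw _ (ht j)
  choose w hwA hwD using hex
  set ind : ℕ → X → ℝ≥0∞ := fun j => (thickening (r / 2 ^ j) F).indicator (fun _ => 1) with hind
  set φ : X → ℝ := fun y => (k : ℝ)⁻¹ * ∑ j ∈ Finset.Icc 1 k, cutoff F (r / 2 ^ j) y with hφ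
  set g : ℤ → X → ℝ≥0∞ := fun n y => ENNReal.ofReal ((k : ℝ)⁻¹) * ∑ j ∈ Finset.Icc 1 k,
    ENNReal.ofReal ((r / 2 ^ j) ^ (-β)) * w j n * ind j y with hg
  have hφc : Continuous φ :=
    continuous_const.mul (continuous_finsetSum _ fun j _ => continuous_cutoff F _)
  have hφ1 : ∀ y ∈ F, 1 ≤ φ y := fun y hy => by
    simp [hφ, cutoff_eq_one hy, hk0.ne']
  have hφ0 : ∀ y ∉ ball x (2 * r), φ y = 0 := fun y hy => by
    rw [hφ]
    refine mul_eq_zero_of_right _ (Finset.sum_eq_zero fun j _ => cutoff_eq_zero (ht j) ?_)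
    refine (div_le_self hr.le (one_le_pow₀ (by norm_num))).trans ((le_infDist hFne).2 ?_)
    intro u hu
    have h1 := mem_closedBall.1 (hF hu)
    have h2 := dist_triangle y u x
    rw [mem_ball, not_lt] at hy
    linarith
  have hgrad : IsFracGrad μ β (ball x (Λ * r)) φ g := by
    refine ⟨fun n => (Finset.measurable_fun_sum _ fun j _ => (measurable_const.indicator
      isOpen_thickening.measurableSet).const_mul _).const_mul _, ∅, Set.empty_subset _,
      measure_empty, fun n u _ v _ hd1 hd2 => ?_⟩
    have hk' : 0 ≤ (k : ℝ)⁻¹ := by positivity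
    calc ENNReal.ofReal |φ u - φ v|
        ≤ ENNReal.ofReal ((k : ℝ)⁻¹ * ∑ j ∈ Finset.Icc 1 k,
            |cutoff F (r / 2 ^ j) u - cutoff F (r / 2 ^ j) v|) := by
          refine ENNReal.ofReal_le_ofReal ?_
          rw [hφ, ← mul_sub, ← Finset.sum_sub_distrib, abs_mul, abs_of_nonneg hk']
          gcongr
          exact Finset.abs_sum_le_sum_abs _ _
      _ = ENNReal.ofReal ((k : ℝ)⁻¹) * ∑ j ∈ Finset.Icc 1 k,
            ENNReal.ofReal |cutoff F (r / 2 ^ j) u - cutoff F (r / 2 ^ j) v| := by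
          rw [ENNReal.ofReal_mul hk', ENNReal.ofReal_sum_of_nonneg fun _ _ => abs_nonneg _]
      _ ≤ ENNReal.ofReal ((k : ℝ)⁻¹) * ∑ j ∈ Finset.Icc 1 k, ENNReal.ofReal (dist u v ^ β) *
            (ENNReal.ofReal ((r / 2 ^ j) ^ (-β)) * w j n) * (ind j u + ind j v) := by
          gcongr with j _
          exact (abs_cutoff_sub_le hFne (ht j) u v).trans
            (mul_le_mul_left (hwD j n _ hd1 hd2) _)
      _ = _ := by
          rw [hg, ← mul_add, ← Finset.sum_add_distrib, mul_left_comm,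
            Finset.mul_sum (a := ENNReal.ofReal (dist u v ^ β))]
          congr 1
          exact Finset.sum_congr rfl fun j _ => by ring
  set a : ℝ≥0∞ := A * ENNReal.ofReal ((k : ℝ)⁻¹) with ha
  have hap : a ^ p = A ^ p * ENNReal.ofReal ((k : ℝ) ^ (-p)) := by
    rw [ha, ENNReal.mul_rpow_of_nonneg _ _ hp.le,
      ENNReal.ofReal_rpow_of_nonneg (by positivity) hp.le, Real.inv_rpow hk0.le,
      Real.rpow_neg hk0.le]
  have hlq : ∀ y, lqNorm q (fun n => g n y) ≤ a * multiscale β r k F y := by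
    intro y
    refine (lqNorm_le_tsum hq _).trans ?_
    simp only [hg]
    rw [ENNReal.tsum_mul_left, Summable.tsum_finsetSum fun _ _ => ENNReal.summable, ha,
      mul_comm A, mul_assoc, multiscale, Finset.mul_sum (a := A)]
    refine mul_le_mul_right (Finset.sum_le_sum fun j _ => ?_) _
    rw [ENNReal.tsum_mul_right, ENNReal.tsum_mul_left]
    calc _ ≤ ENNReal.ofReal ((r / 2 ^ j) ^ (-β)) * A * ind j y := by gcongr; exact hwA j
      _ = _ := by rw [hind]; ring
  calc relCap μ β p q F x r Λ
      ≤ htlSeminorm μ β p q (ball x (Λ * r)) φ ^ p :=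
        iInf_le (fun φ : {φ : X → ℝ // Continuous φ ∧ (∀ x ∈ F, 1 ≤ φ x) ∧
          ∀ y ∉ ball x (2 * r), φ y = 0} => htlSeminorm μ β p q (ball x (Λ * r)) φ.1 ^ p)
          ⟨φ, hφc, hφ1, hφ0⟩
    _ ≤ mixedNorm μ (ball x (Λ * r)) p q g ^ p := by
        gcongr
        exact iInf_le (fun g : {g : ℤ → X → ℝ≥0∞ // IsFracGrad μ β (ball x (Λ * r)) φ g} =>
          mixedNorm μ (ball x (Λ * r)) p q g.1) ⟨g, hgrad⟩
    _ = ∫⁻ y in ball x (Λ * r), lqNorm q (fun n => g n y) ^ p ∂μ := by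
        rw [mixedNorm, ← ENNReal.rpow_mul, one_div_mul_cancel hp.ne', ENNReal.rpow_one]
    _ ≤ ∫⁻ y, lqNorm q (fun n => g n y) ^ p ∂μ := setLIntegral_le_lintegral _ _
    _ ≤ ∫⁻ y, (a * multiscale β r k F y) ^ p ∂μ :=
        lintegral_mono fun y => ENNReal.rpow_le_rpow (hlq y) hp.le
    _ = a ^ p * ∫⁻ y, multiscale β r k F y ^ p ∂μ := by
        rw [← lintegral_const_mul _ ((measurable_multiscale β r k F).pow_const p)]
        simp only [ENNReal.mul_rpow_of_nonneg _ _ hp.le]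
    _ ≤ a ^ p * (C * _) := mul_le_mul_right (hmulti μ r k F hr) _
    _ = _ := by rw [hap]; ring

end RelCapUpper
/-- Two-sided comparison of a set function with codimension `s` contents: an upper bound by sums
over dyadic scales, and a lower bound by Hausdorff contents of smaller codimension. -/
structure HasContentBounds (μ : Measure X) (s p : ℝ) (cap : Set X → X → ℝ → ℝ≥0∞) : Prop where
  upper : ∃ C : ℝ≥0∞, C ≠ ∞ ∧ ∀ (x : X) (r : ℝ) (F : Set X) (k : ℕ), 0 < r → 1 ≤ k →
    ENNReal.ofReal (8 * r) < ediam (Set.univ : Set X) → F.Nonempty → F ⊆ closedBall x r →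
    cap F x r ≤ C * ENNReal.ofReal ((k : ℝ) ^ (-p)) * ∑ j ∈ Finset.Icc 1 k,
      ENNReal.ofReal ((r / 2 ^ j) ^ (-s)) * μ (thickening (r / 2 ^ j) F)
  lower : ∀ d : ℝ, 0 < d → d < s → ∃ C : ℝ≥0∞, C ≠ ∞ ∧ ∀ (x : X) (r : ℝ) (F : Set X), 0 < r →
    ENNReal.ofReal (8 * r) < ediam (Set.univ : Set X) → F ⊆ closedBall x r →
    hContent μ d (ENNReal.ofReal r) F ≤ C * ENNReal.ofReal (r ^ (s - d)) * cap F x r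

/-- The density condition with constants `c₀, c₁` for a set function of localized capacity type. -/
def CapDensity (cap : Set X → X → ℝ → ℝ≥0∞) (E : Set X) (c₀ c₁ : ℝ) : Prop :=
  ∀ x ∈ E, ∀ r : ℝ, 0 < r → ENNReal.ofReal r < ENNReal.ofReal c₁ * ediam E →
    ENNReal.ofReal c₀ * cap (closure (ball x r)) x r ≤ cap (E ∩ closure (ball x r)) x r

lemma exists_ofReal_mul_le {C : ℝ≥0∞} (hC : C ≠ ∞) :
    ∃ c₀ : ℝ, 0 < c₀ ∧ ∀ a b : ℝ≥0∞, a ≤ C * b → ENNReal.ofReal c₀ * a ≤ b := by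
  have h1 : (C + 1)⁻¹ ≠ ∞ := ENNReal.inv_ne_top.2 (by simp)
  have h2 : (C + 1)⁻¹ ≠ 0 := ENNReal.inv_ne_zero.2 (by finiteness)
  refine ⟨(C + 1)⁻¹.toReal, ENNReal.toReal_pos h2 h1, fun a b hab => ?_⟩
  rw [ENNReal.ofReal_toReal h1, mul_comm, ← div_eq_mul_inv]
  exact ENNReal.div_le_of_le_mul' (hab.trans (mul_le_mul_left le_self_add _))

lemma le_inv_mul_of_mul_le {c₀ : ℝ} (h0 : 0 < c₀) {a b : ℝ≥0∞} (h : ENNReal.ofReal c₀ * a ≤ b) :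
    a ≤ (ENNReal.ofReal c₀)⁻¹ * b := by
  rw [mul_comm, ← div_eq_mul_inv, ENNReal.le_div_iff_mul_le
    (Or.inl (ENNReal.ofReal_pos.2 h0).ne') (Or.inl ENNReal.ofReal_ne_top), mul_comm]
  exact h

lemma ofReal_eight_mul_lt {c₁ r : ℝ} {D : ℝ≥0∞} (hc₁ : c₁ ≤ 1 / 8)
    (h : ENNReal.ofReal r < ENNReal.ofReal c₁ * D) : ENNReal.ofReal (8 * r) < D := by
  calc ENNReal.ofReal (8 * r) = 8 * ENNReal.ofReal r := by
        rw [ENNReal.ofReal_mul (by norm_num)]; simp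
    _ < 8 * (ENNReal.ofReal c₁ * D) :=
        (ENNReal.mul_lt_mul_iff_right (by simp) (by simp)).2 h
    _ = ENNReal.ofReal (8 * c₁) * D := by
        rw [ENNReal.ofReal_mul (by norm_num), ← mul_assoc]; simp
    _ ≤ 1 * D := by
        gcongr
        exact ENNReal.ofReal_le_one.2 (by linarith)
    _ = D := one_mul D

section Abstract

variable {μ : Measure X} {c : ℝ≥0∞} {s p : ℝ} {cap : Set X → X → ℝ → ℝ≥0∞}

lemma HasContentBounds.exists_capDensity (hcap : HasContentBounds μ s p cap)
    (h : IsDoublingMeasure μ c) {d : ℝ} (hd0 : 0 < d) (hd : d < s) {E : Set X} {c₀ c₁ : ℝ}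
    (hc₀ : 0 < c₀) (hc₁ : c₁ ≤ 1 / 8) (hE : HausdorffDensity μ d E c₀) :
    ∃ c₀' : ℝ, 0 < c₀' ∧ CapDensity cap E c₀' c₁ := by
  obtain ⟨CU, hCU, hU⟩ := hcap.upper
  obtain ⟨CL, hCL, hL⟩ := hcap.lower d hd0 hd
  have hi : (ENNReal.ofReal c₀)⁻¹ ≠ ∞ := ENNReal.inv_ne_top.2 (ENNReal.ofReal_pos.2 hc₀).ne'
  obtain ⟨c₀', hc₀', hmul⟩ := exists_ofReal_mul_le
    (C := CU * (ENNReal.ofReal (2 ^ s) * c) * ((ENNReal.ofReal c₀)⁻¹ * CL))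
    (by have := h.ne_top; finiteness)
  refine ⟨c₀', hc₀', fun x hx r hr hrE => hmul _ _ ?_⟩
  have h8E := ofReal_eight_mul_lt hc₁ hrE
  have h8 : ENNReal.ofReal (8 * r) < ediam (Set.univ : Set X) :=
    h8E.trans_le (ediam_mono (Set.subset_univ E))
  have hrE' : ENNReal.ofReal r < ediam E :=
    (ENNReal.ofReal_le_ofReal (by linarith)).trans_lt h8E
  have hcl : closure (ball x r) ⊆ closedBall x r := closure_ball_subset_closedBall
  have h1 : μ (ball x r) * ENNReal.ofReal (r ^ (-d)) ≤ (ENNReal.ofReal c₀)⁻¹ *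
      (CL * ENNReal.ofReal (r ^ (s - d)) * cap (E ∩ closure (ball x r)) x r) := by
    refine (le_hContent_of_ball_subset hd0.le subset_closure).trans
      ((le_inv_mul_of_mul_le hc₀ (hE x hx r hr hrE')).trans (mul_le_mul_right ?_ _))
    exact hL x r _ hr h8 (Set.inter_subset_right.trans hcl)
  have h2 := hU x r _ 1 hr le_rfl h8 ⟨x, subset_closure (mem_ball_self hr)⟩ hcl
  have h3 : μ (thickening (r / 2 ^ 1) (closure (ball x r))) ≤ c * μ (ball x r) := by
    refine (measure_mono fun w hw => ?_).trans (h.doubling x r hr)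
    obtain ⟨v, hv, hwv⟩ := mem_thickening_iff.1 hw
    have := mem_closedBall.1 (hcl hv)
    have := dist_triangle w v x
    rw [mem_ball]
    linarith
  have h4 : (r / 2 ^ 1) ^ (-s) = 2 ^ s * r ^ (-(s - d)) * r ^ (-d) := by
    rw [pow_one, Real.div_rpow hr.le (by norm_num), Real.rpow_neg (x := 2) (by norm_num),
      div_inv_eq_mul, mul_assoc, ← Real.rpow_add hr, mul_comm]
    ring_nf
  have h5 : ENNReal.ofReal (r ^ (-(s - d))) * ENNReal.ofReal (r ^ (s - d)) = 1 := by
    rw [← ENNReal.ofReal_mul (by positivity), ← Real.rpow_add hr, neg_add_cancel, Real.rpow_zero,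
      ENNReal.ofReal_one]
  calc cap (closure (ball x r)) x r
      ≤ CU * (ENNReal.ofReal ((r / 2 ^ 1) ^ (-s)) *
          μ (thickening (r / 2 ^ 1) (closure (ball x r)))) := by simpa using h2
    _ ≤ CU * (ENNReal.ofReal ((r / 2 ^ 1) ^ (-s)) * (c * μ (ball x r))) := by gcongr
    _ = CU * (ENNReal.ofReal (2 ^ s) * c) * ENNReal.ofReal (r ^ (-(s - d))) *
          (μ (ball x r) * ENNReal.ofReal (r ^ (-d))) := by
        rw [h4, ENNReal.ofReal_mul (by positivity), ENNReal.ofReal_mul (by positivity)]; ring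
    _ ≤ CU * (ENNReal.ofReal (2 ^ s) * c) * ENNReal.ofReal (r ^ (-(s - d))) *
          ((ENNReal.ofReal c₀)⁻¹ *
            (CL * ENNReal.ofReal (r ^ (s - d)) * cap (E ∩ closure (ball x r)) x r)) :=
        mul_le_mul_right h1 _
    _ = CU * (ENNReal.ofReal (2 ^ s) * c) * ((ENNReal.ofReal c₀)⁻¹ * CL) *
          (ENNReal.ofReal (r ^ (-(s - d))) * ENNReal.ofReal (r ^ (s - d))) *
          cap (E ∩ closure (ball x r)) x r := by ring
    _ = _ := by rw [h5, mul_one]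

/-- The self-improving step: a capacity density condition produces, inside each ball centered at
`E`, a disjoint family of smaller balls centered at `E` of larger total size in some codimension
strictly less than `s`. -/
lemma HasContentBounds.exists_step (hcap : HasContentBounds μ s p cap)
    (h : IsDoublingMeasure μ c) (hs : 0 < s) (hp : 1 < p) {E : Set X} {c₀ c₁ : ℝ}
    (hc₀ : 0 < c₀) (hc₁ : c₁ ≤ 1 / 8) (hE : CapDensity cap E c₀ c₁) :
    ∃ d η : ℝ, 0 < d ∧ d < s ∧ 0 < η ∧ ∀ x ∈ E, ∀ r : ℝ, 0 < r →
      ENNReal.ofReal r < ENNReal.ofReal c₁ * ediam E →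
      ∃ (S : Set X) (ρ : ℝ), S ⊆ E ∧ S.Countable ∧ S.PairwiseDisjoint (fun y => ball y ρ) ∧
        (∀ y ∈ S, ball y ρ ⊆ ball x (2 * r)) ∧ 0 < ρ ∧ η * (2 * r) ≤ ρ ∧ ρ ≤ (2 * r) / 2 ∧
        ENNReal.ofReal ((2 * r) ^ (-d)) * μ (ball x (2 * r)) ≤
          ∑' y : S, ENNReal.ofReal (ρ ^ (-d)) * μ (ball (y : X) ρ) := by
  obtain ⟨CU, hCU, hU⟩ := hcap.upper
  obtain ⟨CL, hCL, hL⟩ := hcap.lower (s / 2) (by linarith) (by linarith)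
  have hi : (ENNReal.ofReal c₀)⁻¹ ≠ ∞ := ENNReal.inv_ne_top.2 (ENNReal.ofReal_pos.2 hc₀).ne'
  set K : ℝ≥0∞ := CL * (ENNReal.ofReal c₀)⁻¹ * CU * c ^ 4 with hK
  have hKtop : K ≠ ∞ := by have := ENNReal.pow_ne_top (n := 4) h.ne_top; finiteness
  obtain ⟨k, hk1, hk⟩ : ∃ k : ℕ, 1 ≤ k ∧ 2 * K.toReal ≤ (k : ℝ) ^ (p - 1) :=
    ((Filter.eventually_ge_atTop 1).and (((tendsto_rpow_atTop (by linarith)).comp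
      tendsto_natCast_atTop_atTop).eventually_ge_atTop _)).exists
  have hk0 : (0 : ℝ) < k := by exact_mod_cast hk1
  set δ : ℝ := min (1 / k) (s / 2) with hδ
  have hδ0 : 0 < δ := lt_min (by positivity) (by linarith)
  have hδs : δ ≤ s / 2 := min_le_right _ _
  have hδk : k * δ ≤ 1 := by
    calc k * δ ≤ k * (1 / k) := by gcongr; exact min_le_left _ _
      _ = 1 := mul_one_div_cancel hk0.ne'
  refine ⟨s - δ, 1 / 2 ^ (k + 1), by linarith, by linarith, by positivity,
    fun x hx r hr hrE => ?_⟩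
  have h8 : ENNReal.ofReal (8 * r) < ediam (Set.univ : Set X) :=
    (ofReal_eight_mul_lt hc₁ hrE).trans_le (ediam_mono (Set.subset_univ E))
  have hcl : closure (ball x r) ⊆ closedBall x r := closure_ball_subset_closedBall
  set F := E ∩ closure (ball x r) with hF
  have hFsub : F ⊆ closedBall x r := Set.inter_subset_right.trans hcl
  have hlow : μ (ball x r) * ENNReal.ofReal (r ^ (-(s / 2))) ≤
      CL * ENNReal.ofReal (r ^ (s - s / 2)) * ((ENNReal.ofReal c₀)⁻¹ * cap F x r) := by
    refine (le_hContent_of_ball_subset (by linarith) subset_closure).trans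
      ((hL x r _ hr h8 hcl).trans (mul_le_mul_right ?_ _))
    exact le_inv_mul_of_mul_le hc₀ (hE x hx r hr hrE)
  have hup := hU x r F k hr hk1 h8 ⟨x, hx, subset_closure (mem_ball_self hr)⟩ hFsub
  obtain ⟨j, hj, hmax⟩ := Finset.exists_max_image (Finset.Icc 1 k) (fun j =>
    ENNReal.ofReal ((r / 2 ^ j) ^ (-s)) * μ (thickening (r / 2 ^ j) F))
    (Finset.nonempty_Icc.2 hk1)
  have hsum := Finset.sum_le_card_nsmul _ _ _ hmax
  rw [Nat.card_Icc, Nat.add_sub_cancel, nsmul_eq_mul] at hsum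
  obtain ⟨hj1, hjk⟩ := Finset.mem_Icc.1 hj
  set ρ := r / 2 ^ j with hρ
  have hρ0 : 0 < ρ := by positivity
  have hρr : ρ ≤ r / 2 := by
    rw [hρ]
    gcongr
    calc (2 : ℝ) = 2 ^ 1 := (pow_one 2).symm
      _ ≤ 2 ^ j := pow_le_pow_right₀ (by norm_num) hj1
  obtain ⟨S, hSF, hSc, hdisj, hcov⟩ := h.exists_covering (F := F) (ρ := fun _ => ρ) hFsub
    (fun _ _ => ⟨hρ0, by linarith⟩)
  have hthick : μ (thickening ρ F) ≤ c ^ 3 * ∑' y : S, μ (ball (y : X) ρ) := by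
    calc μ (thickening ρ F) ≤ μ (⋃ y ∈ S, ball y (6 * ρ)) := by
          refine measure_mono fun w hw => ?_
          obtain ⟨v, hv, hwv⟩ := mem_thickening_iff.1 hw
          obtain ⟨z, hz, hvz⟩ := hcov v hv
          refine Set.mem_biUnion hz (mem_ball.2 ?_)
          linarith [dist_triangle w v z]
      _ ≤ ∑' y : S, μ (ball (y : X) (6 * ρ)) := measure_biUnion_le _ hSc _
      _ ≤ ∑' y : S, c ^ 3 * μ (ball (y : X) ρ) := ENNReal.tsum_le_tsum fun y =>
          h.ball_le 3 hρ0 (by rw [dist_self]; linarith)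
      _ = _ := ENNReal.tsum_mul_left
  refine ⟨S, ρ, hSF.trans Set.inter_subset_left, hSc, hdisj, fun y hy => ball_subset_ball' ?_,
    hρ0, ?_, by linarith, ?_⟩
  · have := mem_closedBall.1 (hFsub (hSF hy))
    linarith
  · calc 1 / 2 ^ (k + 1) * (2 * r) = r / 2 ^ k := by field_simp; ring
      _ ≤ r / 2 ^ j := by gcongr; norm_num
  rw [ENNReal.tsum_mul_left]
  set total := ∑' y : S, μ (ball (y : X) ρ)
  have hmain : μ (ball x (2 * r)) ≤
      K * ENNReal.ofReal (r ^ s * (k : ℝ) ^ (1 - p) * ρ ^ (-s)) * total := by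
    have h1 : ENNReal.ofReal (r ^ (s / 2)) * ENNReal.ofReal (r ^ (-(s / 2))) = 1 := by
      rw [← ENNReal.ofReal_mul (by positivity), ← Real.rpow_add hr, add_neg_cancel,
        Real.rpow_zero, ENNReal.ofReal_one]
    have h2 : r ^ s = r ^ (s / 2) * r ^ (s - s / 2) := by
      rw [← Real.rpow_add hr]; ring_nf
    have h3 : (k : ℝ) ^ (1 - p) = (k : ℝ) ^ (-p) * k := by
      rw [sub_eq_neg_add, Real.rpow_add hk0, Real.rpow_one]
    calc μ (ball x (2 * r)) ≤ c * μ (ball x r) := h.doubling x r hr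
      _ = c * ENNReal.ofReal (r ^ (s / 2)) *
            (μ (ball x r) * ENNReal.ofReal (r ^ (-(s / 2)))) := by
          calc c * μ (ball x r) = c * μ (ball x r) *
                (ENNReal.ofReal (r ^ (s / 2)) * ENNReal.ofReal (r ^ (-(s / 2)))) := by
                rw [h1, mul_one]
            _ = _ := by ring
      _ ≤ c * ENNReal.ofReal (r ^ (s / 2)) * (CL * ENNReal.ofReal (r ^ (s - s / 2)) *
            ((ENNReal.ofReal c₀)⁻¹ * (CU * ENNReal.ofReal ((k : ℝ) ^ (-p)) *
              (k * (ENNReal.ofReal (ρ ^ (-s)) * (c ^ 3 * total)))))) := by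
          refine mul_le_mul_right (hlow.trans (mul_le_mul_right (mul_le_mul_right
            (hup.trans (mul_le_mul_right (hsum.trans (mul_le_mul_right
              (mul_le_mul_right hthick _) _)) _)) _) _)) _
      _ = _ := by
          rw [h2, h3, hK, ENNReal.ofReal_mul (by positivity), ENNReal.ofReal_mul (by positivity),
            ENNReal.ofReal_mul (by positivity), ENNReal.ofReal_mul (by positivity),
            ENNReal.ofReal_natCast]
          ring
  have hconst : (2 * r) ^ (-(s - δ)) * (K.toReal * (r ^ s * (k : ℝ) ^ (1 - p) * ρ ^ (-s))) ≤
      ρ ^ (-(s - δ)) := by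
    have h1 : (2 * r) ^ (-(s - δ)) ≤ r ^ (-(s - δ)) :=
      Real.rpow_le_rpow_of_nonpos hr (by linarith) (by linarith)
    have h2 : r ^ (-(s - δ)) * r ^ s * ρ ^ (-s) = ρ ^ (-(s - δ)) * (r / ρ) ^ δ := by
      rw [Real.div_rpow hr.le hρ0.le, ← Real.rpow_add hr, div_eq_mul_inv,
        ← Real.rpow_neg hρ0.le δ, mul_left_comm, ← Real.rpow_add hρ0]
      ring_nf
    have h3 : (r / ρ) ^ δ ≤ 2 := by
      have : r / ρ = 2 ^ j := by rw [hρ]; field_simp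
      rw [this, ← Real.rpow_natCast, ← Real.rpow_mul (by norm_num)]
      calc (2 : ℝ) ^ (j * δ) ≤ 2 ^ (1 : ℝ) := by
            refine Real.rpow_le_rpow_of_exponent_le (by norm_num) (le_trans ?_ hδk)
            gcongr
        _ = 2 := Real.rpow_one 2
    have h4 : 2 * K.toReal * (k : ℝ) ^ (1 - p) ≤ 1 := by
      calc 2 * K.toReal * (k : ℝ) ^ (1 - p) ≤ (k : ℝ) ^ (p - 1) * (k : ℝ) ^ (1 - p) := by gcongr
        _ = 1 := by rw [← Real.rpow_add hk0]; simp
    have hK0 : 0 ≤ K.toReal := ENNReal.toReal_nonneg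
    calc _ ≤ r ^ (-(s - δ)) * (K.toReal * (r ^ s * (k : ℝ) ^ (1 - p) * ρ ^ (-s))) := by gcongr
      _ = (r ^ (-(s - δ)) * r ^ s * ρ ^ (-s)) * (K.toReal * (k : ℝ) ^ (1 - p)) := by ring
      _ = ρ ^ (-(s - δ)) * ((r / ρ) ^ δ * (K.toReal * (k : ℝ) ^ (1 - p))) := by rw [h2]; ring
      _ ≤ ρ ^ (-(s - δ)) * (2 * (K.toReal * (k : ℝ) ^ (1 - p))) := by gcongr
      _ ≤ ρ ^ (-(s - δ)) * 1 := by gcongr; linarith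
      _ = _ := mul_one _
  calc ENNReal.ofReal ((2 * r) ^ (-(s - δ))) * μ (ball x (2 * r))
      ≤ ENNReal.ofReal ((2 * r) ^ (-(s - δ))) *
          (K * ENNReal.ofReal (r ^ s * (k : ℝ) ^ (1 - p) * ρ ^ (-s)) * total) := by gcongr
    _ = ENNReal.ofReal ((2 * r) ^ (-(s - δ)) *
          (K.toReal * (r ^ s * (k : ℝ) ^ (1 - p) * ρ ^ (-s)))) * total := by
        rw [ENNReal.ofReal_mul (p := (2 * r) ^ (-(s - δ))) (by positivity),
          ENNReal.ofReal_mul ENNReal.toReal_nonneg, ENNReal.ofReal_toReal hKtop]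
        ring
    _ ≤ _ := by gcongr

end Abstract

/-- If every ball centered at `E` contains a disjoint family of smaller balls centered at `E` of
larger total codimension `d` size, then its size is dominated by that of any finite cover. -/
lemma IsDoublingMeasure.ball_le_sum_restrict {μ : Measure X} {E : Set X} {d η R₀ : ℝ} (hd : 0 ≤ d)
    (hstep : ∀ x ∈ E, ∀ R : ℝ, 0 < R → R ≤ R₀ →
      ∃ (S : Set X) (ρ : ℝ), S ⊆ E ∧ S.Countable ∧ S.PairwiseDisjoint (fun y => ball y ρ) ∧
        (∀ y ∈ S, ball y ρ ⊆ ball x R) ∧ 0 < ρ ∧ η * R ≤ ρ ∧ ρ ≤ R / 2 ∧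
        ENNReal.ofReal (R ^ (-d)) * μ (ball x R) ≤
          ∑' y : S, ENNReal.ofReal (ρ ^ (-d)) * μ (ball (y : X) ρ))
    {t : Finset ℕ} {u : ℕ → X} {s : ℕ → ℝ} {m K : ℝ} (hms : ∀ j ∈ t, m ≤ s j)
    (hK : 0 < K) (hKη : 1 ≤ K * η) (n : ℕ) :
    ∀ x ∈ E, ∀ R : ℝ, 0 < R → R ≤ R₀ → R ≤ 2 ^ n * m →
      E ∩ ball x R ⊆ ⋃ j ∈ t, ball (u j) (s j) →
      (∀ j ∈ t, (ball (u j) (s j) ∩ ball x R).Nonempty → s j ≤ K * R) →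
      ENNReal.ofReal (R ^ (-d)) * μ (ball x R) ≤ ENNReal.ofReal (K ^ d) *
        (∑ j ∈ t, ENNReal.ofReal (s j ^ (-d)) • μ.restrict (ball (u j) (3 * s j))) (ball x R) := by
  set ν := ∑ j ∈ t, ENNReal.ofReal (s j ^ (-d)) • μ.restrict (ball (u j) (3 * s j)) with hν
  have large : ∀ x R, 0 < R → ∀ j ∈ t, (ball (u j) (s j) ∩ ball x R).Nonempty → R ≤ s j →
      s j ≤ K * R → ENNReal.ofReal (R ^ (-d)) * μ (ball x R) ≤
        ENNReal.ofReal (K ^ d) * ν (ball x R) := by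
    intro x R hR j hj ⟨z, hzu, hzx⟩ hRs hsK
    have hs : 0 < s j := hR.trans_le hRs
    have hsub : ball x R ⊆ ball (u j) (3 * s j) := by
      refine ball_subset_ball' ?_
      rw [mem_ball] at hzu hzx
      linarith [dist_triangle_left x (u j) z]
    have hν' : ENNReal.ofReal (s j ^ (-d)) * μ (ball x R) ≤ ν (ball x R) := by
      rw [hν, Measure.finsetSum_apply]
      refine le_trans (le_of_eq ?_) (Finset.single_le_sum (fun _ _ => zero_le) hj)
      rw [Measure.smul_apply, Measure.restrict_apply measurableSet_ball,
        Set.inter_eq_left.2 hsub, smul_eq_mul]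
    have hpow : R ^ (-d) ≤ K ^ d * s j ^ (-d) := by
      have h1 : (K * R) ^ (-d) ≤ s j ^ (-d) :=
        Real.rpow_le_rpow_of_nonpos hs hsK (by linarith)
      calc R ^ (-d) = K ^ d * (K * R) ^ (-d) := by
            rw [Real.mul_rpow hK.le hR.le, ← mul_assoc, ← Real.rpow_add hK, add_neg_cancel,
              Real.rpow_zero, one_mul]
        _ ≤ K ^ d * s j ^ (-d) := by gcongr
    calc ENNReal.ofReal (R ^ (-d)) * μ (ball x R)
        ≤ ENNReal.ofReal (K ^ d * s j ^ (-d)) * μ (ball x R) := by gcongr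
      _ = ENNReal.ofReal (K ^ d) * (ENNReal.ofReal (s j ^ (-d)) * μ (ball x R)) := by
          rw [ENNReal.ofReal_mul (by positivity), mul_assoc]
      _ ≤ _ := by gcongr
  induction n with
  | zero =>
    intro x hx R hR _ hRm hcov hsK
    obtain ⟨j, hj, hxj⟩ := Set.mem_iUnion₂.1 (hcov ⟨hx, mem_ball_self hR⟩)
    have hne : (ball (u j) (s j) ∩ ball x R).Nonempty := ⟨x, hxj, mem_ball_self hR⟩
    exact large x R hR j hj hne (by linarith [hms j hj]) (hsK j hj hne)
  | succ n ih =>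
    intro x hx R hR hR₀ hRm hcov hsK
    by_cases hbig : ∃ j ∈ t, (ball (u j) (s j) ∩ ball x R).Nonempty ∧ R ≤ s j
    · obtain ⟨j, hj, hne, hRs⟩ := hbig
      exact large x R hR j hj hne hRs (hsK j hj hne)
    push Not at hbig
    obtain ⟨S, ρ, hSE, hSc, hdisj, hsub, hρ0, hρη, hρR, hle⟩ := hstep x hx R hR hR₀
    refine hle.trans ?_
    calc ∑' y : S, ENNReal.ofReal (ρ ^ (-d)) * μ (ball (y : X) ρ)
        ≤ ∑' y : S, ENNReal.ofReal (K ^ d) * ν (ball (y : X) ρ) := by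
          refine ENNReal.tsum_le_tsum fun ⟨y, hy⟩ => ih y (hSE hy) ρ hρ0 (by linarith) ?_
            ((Set.inter_subset_inter_right E (hsub y hy)).trans hcov) fun j hj hne => ?_
          · rw [pow_succ] at hRm
            linarith
          · have := hbig j hj (hne.mono (Set.inter_subset_inter_right _ (hsub y hy)))
            calc s j ≤ 1 * R := by linarith
              _ ≤ K * η * R := by gcongr
              _ = K * (η * R) := by ring
              _ ≤ K * ρ := by gcongr
      _ = ENNReal.ofReal (K ^ d) * ∑' y : S, ν (ball (y : X) ρ) := ENNReal.tsum_mul_left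
      _ ≤ _ := mul_le_mul_right (IsDoublingMeasure.tsum_ball_le hSc hdisj hsub ν) _

/-- A capacity density condition implies a Hausdorff content density condition of some strictly
smaller codimension. -/
lemma HasContentBounds.exists_hausdorffDensity [CompleteSpace X] {μ : Measure X} {c : ℝ≥0∞}
    {s p : ℝ} {cap : Set X → X → ℝ → ℝ≥0∞} (hcap : HasContentBounds μ s p cap)
    (h : IsDoublingMeasure μ c) (hs : 0 < s) (hp : 1 < p)
    (hsmall : ∀ d, d < s → HasSmallBalls μ d) {E : Set X} (hEc : IsClosed E) {c₀ c₁ : ℝ}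
    (hc₀ : 0 < c₀) (hc₁0 : 0 < c₁) (hc₁ : c₁ ≤ 1 / 8) (hE : CapDensity cap E c₀ c₁) :
    ∃ d : ℝ, 0 < d ∧ d < s ∧ ∃ c₀' : ℝ, 0 < c₀' ∧ HausdorffDensity μ d E c₀' := by
  obtain ⟨d, η, hd0, hds, hη, hstep⟩ := hcap.exists_step h hs hp hc₀ hc₁ hE
  set K : ℝ := max (1 / c₁) (1 / η) with hKdef
  have hK0 : 0 < K := lt_max_of_lt_left (by positivity)
  have hKη : 1 ≤ K * η := (div_le_iff₀ hη).1 (le_max_right _ _)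
  have hKc : 1 ≤ K * c₁ := (div_le_iff₀ hc₁0).1 (le_max_left _ _)
  obtain ⟨N, hN⟩ := pow_unbounded_of_one_lt (1 / c₁) (one_lt_two (α := ℝ))
  obtain ⟨c₀', hc₀', hmul⟩ := exists_ofReal_mul_le
    (C := c ^ 4 * c ^ N * ENNReal.ofReal (K ^ d) * c ^ 2) (by
      have h4 := ENNReal.pow_ne_top (n := 4) h.ne_top
      have hN := ENNReal.pow_ne_top (n := N) h.ne_top
      have h2 := ENNReal.pow_ne_top (n := 2) h.ne_top
      finiteness)
  refine ⟨d, hd0, hds, c₀', hc₀', fun x hx r hr hrE => le_iInf fun ⟨cov, hcov, hsub⟩ => hmul _ _ ?_⟩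
  have hR : 0 < c₁ * r := by positivity
  have hcpt : IsCompact (E ∩ closedBall x (c₁ * r)) := (h.isCompact_closedBall x _).inter_left hEc
  have hsub' : E ∩ closedBall x (c₁ * r) ⊆ ⋃ k, ball (cov k).1 (cov k).2 :=
    (Set.inter_subset_inter_right E ((closedBall_subset_ball (by nlinarith)).trans
      subset_closure)).trans hsub
  obtain ⟨t, ht⟩ := hcpt.elim_finite_subcover _ (fun _ => isOpen_ball) hsub'
  obtain ⟨m, hm, hms⟩ : ∃ m : ℝ, 0 < m ∧ ∀ j ∈ t, m ≤ (cov j).2 := by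
    rcases t.eq_empty_or_nonempty with rfl | hne
    · exact ⟨1, one_pos, by simp⟩
    · obtain ⟨j, hj, hmin⟩ := t.exists_min_image (fun j => (cov j).2) hne
      exact ⟨(cov j).2, (hcov j).1, hmin⟩
  obtain ⟨n, hn⟩ := pow_unbounded_of_one_lt (c₁ * r / m) (one_lt_two (α := ℝ))
  have htree := IsDoublingMeasure.ball_le_sum_restrict (μ := μ) (R₀ := c₁ * r) hd0.le
    (fun y hy R hR0 hRr => ?_) (u := fun j => (cov j).1) (s := fun j => (cov j).2) hms hK0 hKη n
    x hx (c₁ * r) hR le_rfl ((div_lt_iff₀ hm).1 hn).le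
    ((Set.inter_subset_inter_right E ball_subset_closedBall).trans ht) (fun j _ _ => ?_)
  rotate_left
  · have := hstep y hy (R / 2) (by positivity) ?_
    · rwa [mul_div_cancel₀ R two_ne_zero] at this
    calc ENNReal.ofReal (R / 2) ≤ ENNReal.ofReal (c₁ * r) :=
          ENNReal.ofReal_le_ofReal (by linarith)
      _ = ENNReal.ofReal c₁ * ENNReal.ofReal r := ENNReal.ofReal_mul hc₁0.le
      _ < ENNReal.ofReal c₁ * ediam E :=
          (ENNReal.mul_lt_mul_iff_right (ENNReal.ofReal_pos.2 hc₁0).ne' ENNReal.ofReal_ne_top).2 hrE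
  · have h1 : (cov j).2 ≤ r := (ENNReal.ofReal_le_ofReal_iff hr.le).1 (hcov j).2
    calc (cov j).2 ≤ 1 * r := by linarith
      _ ≤ K * c₁ * r := by gcongr
      _ = K * (c₁ * r) := by ring
  have hν : (∑ j ∈ t, ENNReal.ofReal ((cov j).2 ^ (-d)) •
      μ.restrict (ball (cov j).1 (3 * (cov j).2))) (ball x (c₁ * r)) ≤
      c ^ 2 * ∑' k, μ (ball (cov k).1 (cov k).2) * ENNReal.ofReal ((cov k).2 ^ (-d)) := by
    rw [Measure.finsetSum_apply, ← ENNReal.tsum_mul_left]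
    refine (Finset.sum_le_sum fun j _ => ?_).trans (ENNReal.sum_le_tsum t)
    rw [Measure.smul_apply, smul_eq_mul]
    calc _ ≤ ENNReal.ofReal ((cov j).2 ^ (-d)) * (c ^ 2 * μ (ball (cov j).1 (cov j).2)) := by
          refine mul_le_mul_right ((measure_mono (Set.subset_univ _)).trans ?_) _
          rw [Measure.restrict_apply_univ]
          exact h.ball_le 2 (hcov j).1 (by rw [dist_self]; linarith [(hcov j).1])
      _ = _ := by ring
  have hball : μ (ball x r) * ENNReal.ofReal (r ^ (-d)) ≤
      c ^ N * (ENNReal.ofReal ((c₁ * r) ^ (-d)) * μ (ball x (c₁ * r))) := by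
    have h1 : μ (ball x r) ≤ c ^ N * μ (ball x (c₁ * r)) := by
      refine h.ball_le N hR ?_
      have := (div_lt_iff₀ hc₁0).1 hN
      rw [dist_self]
      nlinarith
    have h2 : r ^ (-d) ≤ (c₁ * r) ^ (-d) :=
      Real.rpow_le_rpow_of_nonpos hR (by nlinarith) (by linarith)
    calc _ ≤ c ^ N * μ (ball x (c₁ * r)) * ENNReal.ofReal ((c₁ * r) ^ (-d)) := by gcongr
      _ = _ := by ring
  calc hContent μ d (ENNReal.ofReal r) (closure (ball x r))
      ≤ c ^ 4 * (μ (ball x r) * ENNReal.ofReal (r ^ (-d))) :=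
        (hContent_mono closure_ball_subset_closedBall).trans
          (h.hContent_closedBall_le (hsmall d hds) x hr)
    _ ≤ c ^ 4 * (c ^ N * (ENNReal.ofReal (K ^ d) *
          (c ^ 2 * ∑' k, μ (ball (cov k).1 (cov k).2) * ENNReal.ofReal ((cov k).2 ^ (-d))))) :=
        mul_le_mul_right (hball.trans (mul_le_mul_right
          (htree.trans (mul_le_mul_right hν _)) _)) _
    _ = _ := by ring

lemma IsDoublingMeasure.hasContentBounds_relCap {μ : Measure X} {c : ℝ≥0∞}
    (h : IsDoublingMeasure μ c) (hgeo : IsGeodesicSpace X) {p β Λ : ℝ} {q : ℝ≥0∞} (hp : 1 < p)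
    (hq : 1 ≤ q) (hβ0 : 0 < β) (hβ1 : β < 1) (hs : ∀ d, d < β * p → HasSmallBalls μ d)
    (hΛ : 10 ≤ Λ) :
    HasContentBounds μ (β * p) p (fun F x r => relCap μ β p q F x r Λ) where
  upper := by
    obtain ⟨C, hC, hle⟩ := exists_relCap_le μ hq hβ0 hβ1 (by linarith : 0 < p) Λ
    exact ⟨C, hC, fun x r F k hr hk _ hne hF => hle x r F k hr hk hne hF⟩
  lower d hd0 hd := h.exists_hContent_le_relCap hgeo (zero_lt_one.trans_le hq).ne' hp hβ0.le
    hd0.le hd (hs d hd) hΛ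

lemma IsDoublingMeasure.hasContentBounds_rieszCap [Nontrivial X] {μ : Measure X} {c c' : ℝ≥0∞}
    (h : IsDoublingMeasure μ c) (hgeo : IsGeodesicSpace X) {p β σ : ℝ} (hc' : c' ≠ ∞)
    (hqrd : IsQRD μ σ c') (hp : 1 < p) (hβ : 0 < β) (hσ : β * p < σ)
    (hs : ∀ d, d < β * p → HasSmallBalls μ d) :
    HasContentBounds μ (β * p) p (fun F _ _ => rieszCap μ β p F) where
  upper := by
    obtain ⟨C, hC, hle⟩ := h.exists_rieszCap_le hgeo hβ (by linarith : 0 < p)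
    exact ⟨C, hC, fun x r F k hr hk hD _ _ => hle r F k hr hk
      ((ENNReal.ofReal_le_ofReal (by linarith)).trans_lt hD)⟩
  lower d hd0 hd := by
    obtain ⟨C, hC, hle⟩ :=
      h.exists_hContent_le_rieszCap hc' hqrd hp hβ.le hσ hd0.le hd (hs d hd)
    exact ⟨C, hC, fun x r F hr _ hF => hle x r F hr hF⟩

lemma rieszDensity_iff_capDensity {μ : Measure X} {β p : ℝ} {E : Set X} {c₀ : ℝ} :
    RieszDensity μ β p E c₀ ↔ CapDensity (fun F _ _ => rieszCap μ β p F) E c₀ (1 / 8) := by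
  have hiff : ∀ r : ℝ, ENNReal.ofReal (8 * r) < ediam E ↔
      ENNReal.ofReal r < ENNReal.ofReal (1 / 8) * ediam E := by
    refine fun r => ⟨fun hr => ?_, ofReal_eight_mul_lt le_rfl⟩
    calc ENNReal.ofReal r = ENNReal.ofReal (1 / 8) * ENNReal.ofReal (8 * r) := by
          rw [← ENNReal.ofReal_mul (by norm_num)]
          congr 1
          ring
      _ < ENNReal.ofReal (1 / 8) * ediam E :=
          (ENNReal.mul_lt_mul_iff_right (ENNReal.ofReal_pos.2 (by norm_num)).ne'
            ENNReal.ofReal_ne_top).2 hr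
  exact forall₄_congr fun x _ r _ => imp_congr_left (hiff r)

theorem statement19 [CompleteSpace X]
    (μ : Measure X) [Nontrivial X]
    (c_mu : ℝ≥0∞) (hc1 : 1 < c_mu) (hc2 : c_mu ≠ ∞) (hdbl : IsDoubling μ c_mu)
    (hpos : ∀ (x : X) (r : ℝ), 0 < r → 0 < μ (ball x r))
    (hfin : ∀ (x : X) (r : ℝ), μ (ball x r) ≠ ∞)
    (hgeo : IsGeodesicSpace X)
    (c_sigma : ℝ≥0∞) (p β σ : ℝ) (q : ℝ≥0∞)
    (hp : 1 < p) (hq : 1 < q) (hβ0 : 0 < β) (hβ1 : β < 1)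
    (hσ : β * p < σ) (hcσ0 : 0 < c_sigma) (hcσ1 : c_sigma ≠ ∞) (hqrd : IsQRD μ σ c_sigma)
    (E : Set X) (hE : IsClosed E) :
    ((∃ c₀ > (0:ℝ), ∃ c₁ : ℝ, 0 < c₁ ∧ c₁ ≤ 1/80 ∧ ∃ Λ : ℝ, 41 ≤ Λ ∧
        HTLDensity μ β p q E c₀ c₁ Λ) ↔
      (∃ c₀ > (0:ℝ), RieszDensity μ β p E c₀)) ∧
    ((∃ c₀ > (0:ℝ), ∃ c₁ : ℝ, 0 < c₁ ∧ c₁ ≤ 1/80 ∧ ∃ Λ : ℝ, 41 ≤ Λ ∧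
        HTLDensity μ β p q E c₀ c₁ Λ) ↔
      (∃ d : ℝ, 0 < d ∧ d < β * p ∧ ∃ c₀ > (0:ℝ), HausdorffDensity μ d E c₀)) ∧
    ((∃ c₀ > (0:ℝ), ∃ c₁ : ℝ, 0 < c₁ ∧ c₁ ≤ 1/80 ∧ ∃ Λ : ℝ, 41 ≤ Λ ∧
        HTLDensity μ β p q E c₀ c₁ Λ) ↔
      (∀ Λ c₁ : ℝ, 41 ≤ Λ → 0 < c₁ → c₁ ≤ 1/80 →
        ∃ c₀ > (0:ℝ), HTLDensity μ β p q E c₀ c₁ Λ)) := by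
  have h : IsDoublingMeasure μ c_mu := ⟨hc1.le, hc2, hdbl, hpos, hfin⟩
  have hs : ∀ d, d < β * p → HasSmallBalls μ d := fun d hd x _ hR _ hε =>
    hqrd.exists_small_ball hcσ1 hfin (hd.trans hσ) x hR hε
  have hβp : 0 < β * p := mul_pos hβ0 (by linarith)
  have hrel : ∀ Λ : ℝ, 41 ≤ Λ →
      HasContentBounds μ (β * p) p (fun F x r => relCap μ β p q F x r Λ) := fun Λ hΛ =>
    h.hasContentBounds_relCap hgeo hp hq.le hβ0 hβ1 hs (by linarith)
  have hriesz := h.hasContentBounds_rieszCap hgeo hcσ1 hqrd hp hβ0 hσ hs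
  have hausdorff_of_htl : (∃ c₀ > (0:ℝ), ∃ c₁ : ℝ, 0 < c₁ ∧ c₁ ≤ 1/80 ∧ ∃ Λ : ℝ, 41 ≤ Λ ∧
        HTLDensity μ β p q E c₀ c₁ Λ) →
      ∃ d : ℝ, 0 < d ∧ d < β * p ∧ ∃ c₀ > (0:ℝ), HausdorffDensity μ d E c₀ := by
    rintro ⟨c₀, hc₀, c₁, hc₁0, hc₁, Λ, hΛ, hHTL⟩
    exact (hrel Λ hΛ).exists_hausdorffDensity h hβp hp hs hE hc₀ hc₁0 (by linarith) hHTL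
  have htl_of_hausdorff : (∃ d : ℝ, 0 < d ∧ d < β * p ∧ ∃ c₀ > (0:ℝ), HausdorffDensity μ d E c₀) →
      ∀ Λ c₁ : ℝ, 41 ≤ Λ → 0 < c₁ → c₁ ≤ 1/80 →
        ∃ c₀ > (0:ℝ), HTLDensity μ β p q E c₀ c₁ Λ := by
    rintro ⟨d, hd0, hd, c₀, hc₀, hH⟩ Λ c₁ hΛ _ hc₁
    exact (hrel Λ hΛ).exists_capDensity h hd0 hd hc₀ (by linarith) hH
  have htl_of_forall : (∀ Λ c₁ : ℝ, 41 ≤ Λ → 0 < c₁ → c₁ ≤ 1/80 →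
        ∃ c₀ > (0:ℝ), HTLDensity μ β p q E c₀ c₁ Λ) →
      ∃ c₀ > (0:ℝ), ∃ c₁ : ℝ, 0 < c₁ ∧ c₁ ≤ 1/80 ∧ ∃ Λ : ℝ, 41 ≤ Λ ∧
        HTLDensity μ β p q E c₀ c₁ Λ := by
    intro hall
    obtain ⟨c₀, hc₀, hHTL⟩ := hall 41 (1 / 80) le_rfl (by norm_num) le_rfl
    exact ⟨c₀, hc₀, 1 / 80, by norm_num, le_rfl, 41, le_rfl, hHTL⟩
  refine ⟨⟨fun hHTL => ?_, ?_⟩, ⟨hausdorff_of_htl, htl_of_forall ∘ htl_of_hausdorff⟩,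
    ⟨htl_of_hausdorff ∘ hausdorff_of_htl, htl_of_forall⟩⟩
  · obtain ⟨d, hd0, hd, c₀, hc₀, hH⟩ := hausdorff_of_htl hHTL
    obtain ⟨c₀', hc₀', hcap⟩ := hriesz.exists_capDensity h hd0 hd hc₀ le_rfl hH
    exact ⟨c₀', hc₀', rieszDensity_iff_capDensity.2 hcap⟩
  · rintro ⟨c₀, hc₀, hR⟩
    exact htl_of_forall (htl_of_hausdorff (hriesz.exists_hausdorffDensity h hβp hp hs hE hc₀
      (by norm_num) le_rfl (rieszDensity_iff_capDensity.1 hR)))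

end TLCap

end
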